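/- arXiv:2211.11912 — 9 statements merged into one kernel-verified Lean document; each statement's English description precedes it below -/
import Mathlib

section
/- Let A ∈ ℝ^{m×n}, b ∈ ℝ^m, c ∈ ℝ^n define a well-behaved linear program. Then there exist constants q₀ > 0 and Δ ≥ 0, depending only on A, b, c, such that for every real q with 0 ≤ q ≤ q₀ and every q-quasi-stable coloring (P, Q) of the LP, the reduced LP (Â, b̂, ĉ) satisfies |OPT(A,b,c) − OPT(Â,b̂,ĉ)| ≤ q·Δ. -/
open Matrix BigOperators

/-- The optimal value of the LP `max cᵀx s.t. Ax ≤ b, x ≥ 0`,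
as a supremum in `EReal` (so `⊥ = -∞` if infeasible, `⊤ = +∞` if unbounded). -/
noncomputable def lpOPT {m n : ℕ} (A : Matrix (Fin m) (Fin n) ℝ)
    (b : Fin m → ℝ) (c : Fin n → ℝ) : EReal :=
  sSup ((fun x : Fin n → ℝ => ((c ⬝ᵥ x : ℝ) : EReal)) ''
    {x | (∀ i, A.mulVec x i ≤ b i) ∧ ∀ j, 0 ≤ x j})

/-- The LP is well behaved: its optimal value is finite, and remains finite
in a neighborhood of `(b, c)` (here `‖·‖` on `Fin _ → ℝ` is the sup norm). -/
def WellBehaved {m n : ℕ} (A : Matrix (Fin m) (Fin n) ℝ)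
    (b : Fin m → ℝ) (c : Fin n → ℝ) : Prop :=
  ∃ ε : ℝ, 0 < ε ∧ ∀ (u : Fin m → ℝ) (v : Fin n → ℝ), ‖u‖ ≤ ε → ‖v‖ ≤ ε →
    ∃ y : ℝ, lpOPT A (b + u) (c + v) = (y : EReal)

/-- `P : Fin k → Finset (Fin m)` is a partition of `{0,…,m-1}` into `k` nonempty blocks. -/
def IsColoring {m k : ℕ} (P : Fin k → Finset (Fin m)) : Prop :=
  (∀ i : Fin m, ∃! r, i ∈ P r) ∧ ∀ r, (P r).Nonempty

/-- The coloring `(P, Q)` of the LP `(A, b, c)` is `q`-quasi-stable. -/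
def QStableLP {m n k ℓ : ℕ} (q : ℝ) (A : Matrix (Fin m) (Fin n) ℝ)
    (b : Fin m → ℝ) (c : Fin n → ℝ)
    (P : Fin k → Finset (Fin m)) (Q : Fin ℓ → Finset (Fin n)) : Prop :=
  (∀ r s, ∀ i ∈ P r, ∀ i' ∈ P r,
      |(∑ j ∈ Q s, A i j) - (∑ j ∈ Q s, A i' j)| ≤ q ∧ |b i - b i'| ≤ q) ∧
  (∀ r s, ∀ j ∈ Q s, ∀ j' ∈ Q s,
      |(∑ i ∈ P r, A i j) - (∑ i ∈ P r, A i j')| ≤ q ∧ |c j - c j'| ≤ q)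

/-- The reduced constraint matrix `Â(r,s) = A(P_r,Q_s)/√(|P_r|·|Q_s|)`. -/
noncomputable def reducedA {m n k ℓ : ℕ} (A : Matrix (Fin m) (Fin n) ℝ)
    (P : Fin k → Finset (Fin m)) (Q : Fin ℓ → Finset (Fin n)) :
    Matrix (Fin k) (Fin ℓ) ℝ :=
  fun r s => (∑ i ∈ P r, ∑ j ∈ Q s, A i j) /
    Real.sqrt (((P r).card : ℝ) * ((Q s).card : ℝ))

/-- The reduced right-hand side `b̂(r) = b(P_r)/√|P_r|`. -/
noncomputable def reducedB {m k : ℕ} (b : Fin m → ℝ)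
    (P : Fin k → Finset (Fin m)) : Fin k → ℝ :=
  fun r => (∑ i ∈ P r, b i) / Real.sqrt ((P r).card : ℝ)

/-- The reduced objective `ĉ(s) = c(Q_s)/√|Q_s|`. -/
noncomputable def reducedC {n ℓ : ℕ} (c : Fin n → ℝ)
    (Q : Fin ℓ → Finset (Fin n)) : Fin ℓ → ℝ :=
  fun s => (∑ j ∈ Q s, c j) / Real.sqrt ((Q s).card : ℝ)

def LPFeas {m n : ℕ} (A : Matrix (Fin m) (Fin n) ℝ) (b : Fin m → ℝ) (x : Fin n → ℝ) : Prop :=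
  (∀ i, A.mulVec x i ≤ b i) ∧ ∀ j, 0 ≤ x j

lemma opt_le {m n : ℕ} {A : Matrix (Fin m) (Fin n) ℝ} {b : Fin m → ℝ} {c : Fin n → ℝ} {y : ℝ}
    (h : lpOPT A b c = (y : EReal)) {x : Fin n → ℝ} (hx : LPFeas A b x) : c ⬝ᵥ x ≤ y := by
  have h1 : ((c ⬝ᵥ x : ℝ) : EReal) ≤ lpOPT A b c := le_sSup ⟨x, hx, rfl⟩
  rw [h] at h1
  exact_mod_cast h1

lemma opt_approx {m n : ℕ} {A : Matrix (Fin m) (Fin n) ℝ} {b : Fin m → ℝ} {c : Fin n → ℝ} {y : ℝ}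
    (h : lpOPT A b c = (y : EReal)) {d : ℝ} (hd : d < y) :
    ∃ x, LPFeas A b x ∧ d < c ⬝ᵥ x := by
  have h1 : (d : EReal) < lpOPT A b c := by rw [h]; exact_mod_cast hd
  obtain ⟨_, ⟨x, hx, rfl⟩, h2⟩ := lt_sSup_iff.1 h1
  exact ⟨x, hx, EReal.coe_lt_coe_iff.1 h2⟩

lemma opt_upper {m n : ℕ} {A : Matrix (Fin m) (Fin n) ℝ} {b : Fin m → ℝ} {c : Fin n → ℝ} {y B : ℝ}
    (h : lpOPT A b c = (y : EReal)) (hB : ∀ x, LPFeas A b x → c ⬝ᵥ x ≤ B) : y ≤ B := by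
  by_contra hlt
  obtain ⟨x, hx, h2⟩ := opt_approx h (not_le.1 hlt)
  exact absurd (hB x hx) (not_le.2 h2)

lemma opt_exists {m n : ℕ} {A : Matrix (Fin m) (Fin n) ℝ} {b : Fin m → ℝ} {c : Fin n → ℝ} {B : ℝ}
    {x : Fin n → ℝ} (hx : LPFeas A b x) (hB : ∀ x, LPFeas A b x → c ⬝ᵥ x ≤ B) :
    ∃ y : ℝ, lpOPT A b c = (y : EReal) := by
  have h1 : ((c ⬝ᵥ x : ℝ) : EReal) ≤ lpOPT A b c := le_sSup ⟨x, hx, rfl⟩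
  have h2 : lpOPT A b c ≤ (B : EReal) := by
    refine sSup_le ?_
    rintro _ ⟨z, hz, rfl⟩
    have := hB z hz
    exact EReal.coe_le_coe_iff.2 this
  refine ⟨(lpOPT A b c).toReal, (EReal.coe_toReal ?_ ?_).symm⟩
  · exact ne_top_of_le_ne_top (EReal.coe_ne_top B) h2
  · intro h; rw [h] at h1; exact EReal.coe_ne_bot _ (le_bot_iff.1 h1)

lemma avg_close {ι : Type*} (S : Finset ι) (f : ι → ℝ) (q : ℝ)
    (h : ∀ j ∈ S, ∀ j' ∈ S, |f j - f j'| ≤ q) {j : ι} (hj : j ∈ S) :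
    |(∑ i ∈ S, f i) / (S.card : ℝ) - f j| ≤ q := by
  have hc : (0 : ℝ) < S.card := by exact_mod_cast Finset.card_pos.2 ⟨j, hj⟩
  have e : (∑ i ∈ S, f i) / (S.card : ℝ) - f j = (∑ i ∈ S, (f i - f j)) / (S.card : ℝ) := by
    rw [Finset.sum_sub_distrib, Finset.sum_const, nsmul_eq_mul]
    field_simp
  rw [e, abs_div, abs_of_pos hc, div_le_iff₀ hc]
  calc _ ≤ ∑ i ∈ S, |f i - f j| := Finset.abs_sum_le_sum_abs _ _
    _ ≤ ∑ i ∈ S, q := Finset.sum_le_sum fun i hi => h i hi j hj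
    _ = q * S.card := by rw [Finset.sum_const, nsmul_eq_mul, mul_comm]

lemma avg_prod {ι : Type*} (S : Finset ι) (f x : ι → ℝ) (q : ℝ) (hx : ∀ j, 0 ≤ x j)
    (h : ∀ j ∈ S, ∀ j' ∈ S, |f j - f j'| ≤ q) :
    |(∑ i ∈ S, f i) / (S.card : ℝ) * (∑ i ∈ S, x i) - ∑ i ∈ S, f i * x i| ≤ q * ∑ i ∈ S, x i := by
  rw [Finset.mul_sum, ← Finset.sum_sub_distrib, Finset.mul_sum]
  refine (Finset.abs_sum_le_sum_abs _ _).trans (Finset.sum_le_sum fun j hj => ?_)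
  rw [← sub_mul, abs_mul, abs_of_nonneg (hx j)]
  exact mul_le_mul_of_nonneg_right (avg_close S f q h hj) (hx j)

lemma part_sum {n l : ℕ} {Q : Fin l → Finset (Fin n)} (hQ : IsColoring Q) (f : Fin n → ℝ) :
    ∑ j, f j = ∑ s, ∑ j ∈ Q s, f j := by
  have h : ∀ s, ∑ j ∈ Q s, f j = ∑ j, if j ∈ Q s then f j else 0 := by
    intro s; simp
  simp_rw [h]
  rw [Finset.sum_comm]
  refine Finset.sum_congr rfl fun j _ => ?_
  obtain ⟨s, hs, hu⟩ := hQ.1 j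
  rw [Finset.sum_eq_single s]
  · simp [show j ∈ Q s from hs]
  · intro t _ ht
    exact if_neg fun h => ht (hu t h)
  · simp

/-- restriction -/
noncomputable def redX {n l : ℕ} (Q : Fin l → Finset (Fin n)) (x : Fin n → ℝ) : Fin l → ℝ :=
  fun s => (∑ j ∈ Q s, x j) / Real.sqrt ((Q s).card : ℝ)

lemma d1_obj {n l : ℕ} {Q : Fin l → Finset (Fin n)} (hQ : IsColoring Q) (c x : Fin n → ℝ) (q : ℝ)
    (hx : ∀ j, 0 ≤ x j) (h : ∀ s, ∀ j ∈ Q s, ∀ j' ∈ Q s, |c j - c j'| ≤ q) :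
    |reducedC c Q ⬝ᵥ redX Q x - c ⬝ᵥ x| ≤ q * ∑ j, x j := by
  have e : reducedC c Q ⬝ᵥ redX Q x
      = ∑ s, (∑ j ∈ Q s, c j) / ((Q s).card : ℝ) * ∑ j ∈ Q s, x j := by
    refine Finset.sum_congr rfl fun s _ => ?_
    simp only [reducedC, redX]
    rw [div_mul_div_comm, Real.mul_self_sqrt (Nat.cast_nonneg _), div_mul_eq_mul_div]
  rw [e, dotProduct, part_sum hQ, part_sum hQ x, ← Finset.sum_sub_distrib, Finset.mul_sum]
  refine (Finset.abs_sum_le_sum_abs _ _).trans (Finset.sum_le_sum fun s _ => ?_)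
  exact avg_prod _ _ _ _ hx (h s)

lemma red_mulVec {m n k l : ℕ} (A : Matrix (Fin m) (Fin n) ℝ) {P : Fin k → Finset (Fin m)}
    (hP : IsColoring P) (Q : Fin l → Finset (Fin n)) (w : Fin l → ℝ) (r : Fin k) :
    Real.sqrt ((P r).card : ℝ) * (reducedA A P Q).mulVec w r
      = ∑ s, (∑ i ∈ P r, ∑ j ∈ Q s, A i j) * (w s / Real.sqrt ((Q s).card : ℝ)) := by
  have hp : (0 : ℝ) < Real.sqrt ((P r).card : ℝ) :=
    Real.sqrt_pos.2 (by exact_mod_cast Finset.card_pos.2 (hP.2 r))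
  simp only [Matrix.mulVec, dotProduct, reducedA]
  rw [Finset.mul_sum]
  refine Finset.sum_congr rfl fun s _ => ?_
  rw [Real.sqrt_mul (Nat.cast_nonneg _)]
  by_cases h0 : Real.sqrt ((Q s).card : ℝ) = 0
  · simp [h0]
  · field_simp

lemma d1_row {m n k l : ℕ} (A : Matrix (Fin m) (Fin n) ℝ) {P : Fin k → Finset (Fin m)}
    (hP : IsColoring P) {Q : Fin l → Finset (Fin n)} (hQ : IsColoring Q) (x : Fin n → ℝ) (q : ℝ)
    (hx : ∀ j, 0 ≤ x j)
    (h : ∀ r s, ∀ j ∈ Q s, ∀ j' ∈ Q s, |(∑ i ∈ P r, A i j) - (∑ i ∈ P r, A i j')| ≤ q) (r : Fin k) :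
    Real.sqrt ((P r).card : ℝ) * (reducedA A P Q).mulVec (redX Q x) r
      ≤ ∑ i ∈ P r, A.mulVec x i + q * ∑ j, x j := by
  have := d1_obj hQ (fun j => ∑ i ∈ P r, A i j) x q hx (h r)
  rw [red_mulVec A hP]
  have e1 : ∑ s, (∑ i ∈ P r, ∑ j ∈ Q s, A i j) * (redX Q x s / Real.sqrt ((Q s).card : ℝ))
      = reducedC (fun j => ∑ i ∈ P r, A i j) Q ⬝ᵥ redX Q x := by
    refine Finset.sum_congr rfl fun s _ => ?_
    simp only [reducedC]
    rw [Finset.sum_comm]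
    ring
  have e2 : ∑ i ∈ P r, A.mulVec x i = (fun j => ∑ i ∈ P r, A i j) ⬝ᵥ x := by
    simp only [Matrix.mulVec, dotProduct]
    rw [Finset.sum_comm]
    simp_rw [Finset.sum_mul]
  rw [e1, e2]
  linarith [(abs_le.1 this).2]

/-- lifting -/
lemma lift_exists {m n k l : ℕ} (A : Matrix (Fin m) (Fin n) ℝ) (b : Fin m → ℝ) (c : Fin n → ℝ)
    {P : Fin k → Finset (Fin m)} {Q : Fin l → Finset (Fin n)}
    (hP : IsColoring P) (hQ : IsColoring Q) (q : ℝ) (hq : 0 ≤ q)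
    (hS : QStableLP q A b c P Q) (x0 : Fin n → ℝ) (hx0 : LPFeas A b x0)
    (w : Fin l → ℝ) (hw : LPFeas (reducedA A P Q) (reducedB b P) w) :
    ∃ x : Fin n → ℝ, (∀ j, 0 ≤ x j) ∧ c ⬝ᵥ x = reducedC c Q ⬝ᵥ w ∧
      ∀ i, A.mulVec x i ≤ b i + q * (1 + ∑ j, x j) := by
  choose col hcol hu using hQ.1
  have hz : ∀ s, 0 ≤ w s / Real.sqrt ((Q s).card : ℝ) := fun s =>
    div_nonneg (hw.2 s) (Real.sqrt_nonneg _)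
  set z : Fin l → ℝ := fun s => w s / Real.sqrt ((Q s).card : ℝ) with hzdef
  have hxz : ∀ f : Fin n → ℝ, ∑ j, f j * z (col j) = ∑ s, (∑ j ∈ Q s, f j) * z s := by
    intro f
    rw [part_sum hQ]
    refine Finset.sum_congr rfl fun s _ => ?_
    rw [Finset.sum_mul]
    refine Finset.sum_congr rfl fun j hj => ?_
    rw [hu j s hj]
  have hx1 : ∑ s, z s ≤ ∑ j, z (col j) := by
    have := hxz (fun _ => 1)
    simp only [one_mul, Finset.sum_const, nsmul_eq_mul, mul_one] at this
    rw [this]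
    refine Finset.sum_le_sum fun s _ => ?_
    have h1 : (1 : ℝ) ≤ (Q s).card := by exact_mod_cast Finset.card_pos.2 (hQ.2 s)
    nlinarith [hz s]
  refine ⟨fun j => z (col j), fun j => hz _, ?_, ?_⟩
  · simp only [dotProduct]
    rw [hxz]
    refine Finset.sum_congr rfl fun s _ => ?_
    simp only [reducedC, hzdef]
    ring
  · intro i
    obtain ⟨r, hr, -⟩ := hP.1 i
    rcases isEmpty_or_nonempty (Fin l) with he | ⟨⟨s0⟩⟩
    · have : IsEmpty (Fin n) := ⟨fun j => he.elim (col j)⟩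
      have e : (fun j => z (col j)) = x0 := Subsingleton.elim _ _
      rw [e]
      have := hx0.1 i
      simp
      linarith
    · have hb := avg_close (P r) b q (fun i hi i' hi' => (hS.1 r s0 i hi i' hi').2) hr
      have hc : (0 : ℝ) < (P r).card := by exact_mod_cast Finset.card_pos.2 (hP.2 r)
      have hrow : ∑ s, (∑ i ∈ P r, ∑ j ∈ Q s, A i j) * z s ≤ ∑ i ∈ P r, b i := by
        have h1 := red_mulVec A hP Q w r
        have h2 := mul_le_mul_of_nonneg_left (hw.1 r) (Real.sqrt_nonneg ((P r).card : ℝ))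
        rw [h1] at h2
        refine h2.trans (le_of_eq ?_)
        simp only [reducedB]
        have := Real.sqrt_pos.2 hc
        field_simp
      have h3 : A.mulVec (fun j => z (col j)) i
          ≤ ∑ s, ((∑ i ∈ P r, ∑ j ∈ Q s, A i j) / ((P r).card : ℝ) + q) * z s := by
        simp only [Matrix.mulVec, dotProduct]
        rw [hxz]
        refine Finset.sum_le_sum fun s _ => mul_le_mul_of_nonneg_right ?_ (hz s)
        have := avg_close (P r) (fun i => ∑ j ∈ Q s, A i j) q
          (fun i hi i' hi' => (hS.1 r s i hi i' hi').1) hr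
        linarith [(abs_le.1 this).1]
      have h4 : ∑ s, ((∑ i ∈ P r, ∑ j ∈ Q s, A i j) / ((P r).card : ℝ) + q) * z s
          = (∑ s, (∑ i ∈ P r, ∑ j ∈ Q s, A i j) * z s) / ((P r).card : ℝ) + q * ∑ s, z s := by
        rw [Finset.sum_div, Finset.mul_sum, ← Finset.sum_add_distrib]
        refine Finset.sum_congr rfl fun s _ => ?_
        ring
      have h5 := div_le_div_of_nonneg_right hrow hc.le
      have h6 := mul_le_mul_of_nonneg_left hx1 hq
      have := (abs_le.1 hb).2
      linarith

lemma mix_feas {m n : ℕ} (A : Matrix (Fin m) (Fin n) ℝ) (b d d' : Fin m → ℝ) (x x0 : Fin n → ℝ)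
    (t : ℝ) (h0 : 0 ≤ t) (h1 : t ≤ 1) (hx : LPFeas A d x) (hx0 : LPFeas A d' x0)
    (hb : ∀ i, (1 - t) * d i + t * d' i ≤ b i) : LPFeas A b ((1 - t) • x + t • x0) := by
  constructor
  · intro i
    rw [Matrix.mulVec_add, Matrix.mulVec_smul, Matrix.mulVec_smul]
    simp only [Pi.add_apply, Pi.smul_apply, smul_eq_mul]
    have := mul_le_mul_of_nonneg_left (hx.1 i) (sub_nonneg.2 h1)
    have := mul_le_mul_of_nonneg_left (hx0.1 i) h0
    linarith [hb i]
  · intro j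
    simp only [Pi.add_apply, Pi.smul_apply, smul_eq_mul]
    have := mul_nonneg (sub_nonneg.2 h1) (hx.2 j)
    have := mul_nonneg h0 (hx0.2 j)
    linarith

lemma mix_dot {n : ℕ} (c x x0 : Fin n → ℝ) (t : ℝ) :
    c ⬝ᵥ ((1 - t) • x + t • x0) = (1 - t) * (c ⬝ᵥ x) + t * (c ⬝ᵥ x0) := by
  simp [dotProduct_add, dotProduct_smul]

lemma mix_sum {n : ℕ} (x x0 : Fin n → ℝ) (t : ℝ) :
    ∑ j, ((1 - t) • x + t • x0) j = (1 - t) * (∑ j, x j) + t * (∑ j, x0 j) := by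
  simp [Finset.sum_add_distrib, Finset.mul_sum]

/-- For a well-behaved LP there exist `q₀ > 0` and `Δ ≥ 0`, depending only on
`A, b, c`, such that for every `0 ≤ q ≤ q₀` and every `q`-quasi-stable coloring,
the optimal values of the LP and the reduced LP differ by at most `q·Δ`. -/
theorem quasi_stable_lp_approx {m n : ℕ} (A : Matrix (Fin m) (Fin n) ℝ)
    (b : Fin m → ℝ) (c : Fin n → ℝ) (hwb : WellBehaved A b c) :
    ∃ q₀ > (0 : ℝ), ∃ Δ ≥ (0 : ℝ), ∀ q : ℝ, 0 ≤ q → q ≤ q₀ →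
      ∀ (k ℓ : ℕ) (P : Fin k → Finset (Fin m)) (Q : Fin ℓ → Finset (Fin n)),
        IsColoring P → IsColoring Q → QStableLP q A b c P Q →
        ∃ y yhat : ℝ, lpOPT A b c = (y : EReal) ∧
          lpOPT (reducedA A P Q) (reducedB b P) (reducedC c Q) = (yhat : EReal) ∧
          |y - yhat| ≤ q * Δ := by
  classical
  obtain ⟨e, he, hw⟩ := hwb
  have hconst : ∀ (k : ℕ) (a : ℝ), |a| ≤ e → ‖(fun _ : Fin k => a)‖ ≤ e := by
    intro k a ha
    exact (pi_norm_le_iff_of_nonneg he.le).2 fun _ => ha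
  have hee : |e| ≤ e := (abs_of_pos he).le
  have hne : |(-e)| ≤ e := by rw [abs_neg]; exact hee
  obtain ⟨y, hy⟩ : ∃ y : ℝ, lpOPT A b c = (y : EReal) := by
    have := hw 0 0 (by simpa using he.le) (by simpa using he.le)
    simpa using this
  obtain ⟨M, hM⟩ : ∃ y : ℝ, lpOPT A b (c + fun _ => e) = (y : EReal) := by
    have := hw 0 (fun _ => e) (by simpa using he.le) (hconst _ _ hee)
    simpa using this
  -- Slater point
  obtain ⟨x0, hx0⟩ : ∃ x0, LPFeas A (fun i => b i - e) x0 := by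
    obtain ⟨y1, hy1⟩ := hw (fun _ => -e) 0 (hconst _ _ hne) (by simpa using he.le)
    obtain ⟨x, hx, -⟩ := opt_approx hy1 (sub_one_lt y1)
    exact ⟨x, fun i => by simpa [sub_eq_add_neg] using hx.1 i, hx.2⟩
  have hx0' : LPFeas A b x0 := ⟨fun i => by have := hx0.1 i; linarith, hx0.2⟩
  have hMb : ∀ x, LPFeas A b x → c ⬝ᵥ x + e * ∑ j, x j ≤ M := by
    intro x hx
    have := opt_le hM hx
    rw [add_dotProduct] at this
    have e2 : (fun _ : Fin n => e) ⬝ᵥ x = e * ∑ j, x j := by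
      simp [dotProduct, Finset.mul_sum]
    linarith
  have hN : ∀ x : Fin n → ℝ, (∀ j, 0 ≤ x j) → 0 ≤ ∑ j, x j := fun x hx =>
    Finset.sum_nonneg fun j _ => hx j
  have hyx0 : c ⬝ᵥ x0 ≤ y := opt_le hy hx0'
  have hMx0 := hMb x0 hx0'
  have hN0 := hN x0 hx0.2
  have hyM : y ≤ M := opt_upper hy fun x hx => by
    have := hMb x hx
    have := mul_nonneg he.le (hN x hx.2)
    linarith
  set K0 : ℝ := c ⬝ᵥ x0 + e * ∑ j, x0 j with hK0
  set g : ℝ := y - c ⬝ᵥ x0 with hg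
  have hg0 : 0 ≤ g := by linarith
  set R : ℝ := 2 * (M - y + 1 + e) / e + ∑ j, x0 j with hR
  have hR1 : 0 < 2 * (M - y + 1 + e) / e := by
    apply div_pos _ he; linarith
  have hR0 : 0 < R := by linarith
  have hRe : 2 * (M - y + 1 + e) ≤ R * e := by
    have : R * e = 2 * (M - y + 1 + e) + (∑ j, x0 j) * e := by
      rw [hR]; field_simp
    rw [this]
    have := mul_nonneg hN0 he.le
    linarith
  have hR2 : ∑ j, x0 j ≤ R := by linarith
  refine ⟨min (e / R) (e ^ 2 / (2 * (M - K0 + 1))), lt_min (by positivity)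
    (div_pos (by positivity) (by linarith)), (1 + R) * g / e + R, by positivity, ?_⟩
  intro q hq0 hq k l P Q hP hQ hS
  have hq1 : q * R ≤ e := by
    have := hq.trans (min_le_left _ _)
    rwa [le_div_iff₀ hR0] at this
  have hq2 : q * (M - K0) ≤ e ^ 2 / 2 := by
    have h1 := hq.trans (min_le_right _ _)
    rw [le_div_iff₀ (by linarith)] at h1
    linarith
  -- direction 2
  have key : ∀ w, LPFeas (reducedA A P Q) (reducedB b P) w →
      ∃ (t N : ℝ), 0 ≤ N ∧ t = q * (1 + N) ∧
      e * (reducedC c Q ⬝ᵥ w) + t * (c ⬝ᵥ x0) ≤ y * (t + e) ∧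
      reducedC c Q ⬝ᵥ w + e * N / 2 ≤ M + e / 2 := by
    intro w hw'
    obtain ⟨x, hx, hcx, hAx⟩ := lift_exists A b c hP hQ q hq0 hS x0 hx0' w hw'
    have hNx := hN x hx
    set N := ∑ j, x j with hNdef
    have ht : 0 ≤ q * (1 + N) := by positivity
    refine ⟨q * (1 + N), N, hNx, rfl, ?_⟩
    rw [← hcx]
    set t := q * (1 + N) with htdef
    have hte : 0 < t + e := by linarith
    have hl0 : 0 ≤ t / (t + e) := by positivity
    have hl1 : t / (t + e) ≤ 1 := by rw [div_le_one hte]; linarith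
    have hf : LPFeas A b ((1 - t / (t + e)) • x + (t / (t + e)) • x0) := by
      refine mix_feas A b (fun i => b i + t) (fun i => b i - e) x x0 _ hl0 hl1 ⟨hAx, hx⟩ hx0 ?_
      intro i
      apply le_of_eq
      field_simp
      ring
    have el : 1 - t / (t + e) = e / (t + e) := by field_simp; ring
    have h1 := opt_le hy hf
    have h2 := hMb _ hf
    rw [mix_dot, el] at h1
    rw [mix_dot, mix_sum, el] at h2
    have h1' : e * (c ⬝ᵥ x) + t * (c ⬝ᵥ x0) ≤ y * (t + e) := by
      rw [← div_le_iff₀ hte]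
      refine le_trans (le_of_eq ?_) h1
      ring
    have h2' : e * (c ⬝ᵥ x + e * N) + t * K0 ≤ M * (t + e) := by
      rw [← div_le_iff₀ hte]
      refine le_trans (le_of_eq ?_) h2
      rw [hK0]
      ring
    refine ⟨h1', ?_⟩
    have h3 : t * (M - K0) ≤ e ^ 2 / 2 * (1 + N) := by
      have := mul_le_mul_of_nonneg_right hq2 (by linarith : 0 ≤ 1 + N)
      calc t * (M - K0) = q * (M - K0) * (1 + N) := by rw [htdef]; ring
        _ ≤ _ := this
    have h4 : e * (c ⬝ᵥ x + e * N / 2) ≤ e * (M + e / 2) := by nlinarith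
    exact le_of_mul_le_mul_left h4 he
  -- direction 1
  have dir1 : ∀ x, LPFeas A b x → y - 1 ≤ c ⬝ᵥ x →
      ∃ w, LPFeas (reducedA A P Q) (reducedB b P) w ∧
        c ⬝ᵥ x - q * (R * g / e + R) ≤ reducedC c Q ⬝ᵥ w := by
    intro x hx hcx
    have hNx := hN x hx.2
    have hxR : ∑ j, x j ≤ R := by
      have h1 := hMb x hx
      have : e * ∑ j, x j ≤ e * R := by nlinarith
      exact le_of_mul_le_mul_left this he
    set t := q * R / e with ht
    have ht0 : 0 ≤ t := by positivity
    have ht1 : t ≤ 1 := by rw [ht, div_le_one he]; exact hq1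
    have hte : t * e = q * R := by rw [ht]; field_simp
    have hf : LPFeas A (fun i => b i - q * R) ((1 - t) • x + t • x0) := by
      refine mix_feas A _ b (fun i => b i - e) x x0 _ ht0 ht1 hx hx0 ?_
      intro i
      apply le_of_eq
      rw [← hte]
      ring
    set x' := (1 - t) • x + t • x0 with hx'
    have hsum : ∑ j, x' j ≤ R := by
      rw [hx', mix_sum]
      nlinarith
    have hdot : c ⬝ᵥ x' = (1 - t) * (c ⬝ᵥ x) + t * (c ⬝ᵥ x0) := mix_dot _ _ _ _
    have hqs := mul_le_mul_of_nonneg_left hsum hq0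
    have hfeas : LPFeas (reducedA A P Q) (reducedB b P) (redX Q x') := by
      constructor
      · intro r
        have hc1 : (1 : ℝ) ≤ (P r).card := by exact_mod_cast Finset.card_pos.2 (hP.2 r)
        have hsq : 0 < Real.sqrt ((P r).card : ℝ) := Real.sqrt_pos.2 (by linarith)
        have h1 := d1_row A hP hQ x' q hf.2
          (fun r s j hj j' hj' => (hS.2 r s j hj j' hj').1) r
        have h2 : ∑ i ∈ P r, A.mulVec x' i ≤ ∑ i ∈ P r, b i - (P r).card * (q * R) := by
          refine (Finset.sum_le_sum fun i _ => hf.1 i).trans (le_of_eq ?_)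
          rw [Finset.sum_sub_distrib, Finset.sum_const, nsmul_eq_mul]
        have h3 : q * R ≤ (P r).card * (q * R) :=
          le_mul_of_one_le_left (by positivity) hc1
        simp only [reducedB]
        rw [le_div_iff₀ hsq, mul_comm]
        linarith
      · intro s
        exact div_nonneg (Finset.sum_nonneg fun j _ => hf.2 j) (Real.sqrt_nonneg _)
    rcases isEmpty_or_nonempty (Fin k) with hk | ⟨⟨r0⟩⟩
    · refine ⟨0, ⟨fun r => hk.elim r, fun _ => le_rfl⟩, ?_⟩
      have hmE : IsEmpty (Fin m) := ⟨fun i => by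
        obtain ⟨r, -, -⟩ := hP.1 i
        exact hk.elim r⟩
      have hcx0 : c ⬝ᵥ x ≤ 0 := by
        by_contra hpos
        push Not at hpos
        have hK : 0 ≤ (|y| + 1) / (c ⬝ᵥ x) := by positivity
        have := opt_le (x := ((|y| + 1) / (c ⬝ᵥ x)) • x) hy
          ⟨fun i => hmE.elim i, fun j => mul_nonneg hK (hx.2 j)⟩
        rw [dotProduct_smul, smul_eq_mul, div_mul_cancel₀ _ hpos.ne'] at this
        linarith [le_abs_self y]
      have : 0 ≤ q * (R * g / e + R) := by positivity
      rw [dotProduct_zero]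
      linarith
    · refine ⟨redX Q x', hfeas, ?_⟩
      have h1 := d1_obj hQ c x' q hf.2 (fun s j hj j' hj' => (hS.2 r0 s j hj j' hj').2)
      have h2 := (abs_le.1 h1).1
      have h3 := opt_le hy hx
      have h4 : t * (c ⬝ᵥ x - c ⬝ᵥ x0) ≤ t * g :=
        mul_le_mul_of_nonneg_left (by linarith) ht0
      have h5 : q * (R * g / e + R) = t * g + q * R := by rw [ht]; ring
      rw [h5]
      linarith
  obtain ⟨xs, hxs, hxs1⟩ := opt_approx hy (sub_one_lt y)
  obtain ⟨ws, hws, -⟩ := dir1 xs hxs hxs1.le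
  obtain ⟨yh, hyh⟩ := opt_exists (c := reducedC c Q) (B := M + e / 2) hws (fun w hw' => by
    obtain ⟨t, N, hN', -, -, h⟩ := key w hw'
    have : 0 ≤ e * N / 2 := by positivity
    linarith)
  refine ⟨y, yh, hy, hyh, ?_⟩
  have up : yh ≤ y + q * ((1 + R) * g / e) := by
    refine opt_upper hyh fun w hw' => ?_
    obtain ⟨t, N, hN', ht, h1, h2⟩ := key w hw'
    have hpos : 0 ≤ q * ((1 + R) * g / e) := by positivity
    by_cases hc : reducedC c Q ⬝ᵥ w ≤ y
    · linarith
    · push Not at hc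
      have hNR : N ≤ R := by
        have : e * N ≤ e * R := by nlinarith
        exact le_of_mul_le_mul_left this he
      have htR : t * g ≤ q * (1 + R) * g := by
        apply mul_le_mul_of_nonneg_right _ hg0
        rw [ht]
        exact mul_le_mul_of_nonneg_left (by linarith) hq0
      have h3 : e * (reducedC c Q ⬝ᵥ w) ≤ e * (y + q * ((1 + R) * g / e)) := by
        have : e * (y + q * ((1 + R) * g / e)) = e * y + q * (1 + R) * g := by field_simp
        rw [this]
        have : t * g = t * y - t * (c ⬝ᵥ x0) := by rw [hg]; ring
        linarith
      exact le_of_mul_le_mul_left h3 he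
  have low : y ≤ yh + q * (R * g / e + R) := by
    by_contra hlt
    push Not at hlt
    obtain ⟨x, hx, h1⟩ := opt_approx hy (max_lt hlt (sub_one_lt y))
    obtain ⟨w, hw', h2⟩ := dir1 x hx ((le_max_right _ _).trans h1.le)
    have h3 := opt_le hyh hw'
    have := (le_max_left (yh + q * (R * g / e + R)) (y - 1)).trans_lt h1
    linarith
  have e1 : q * ((1 + R) * g / e + R) = q * ((1 + R) * g / e) + q * R := by ring
  have e2 : q * ((1 + R) * g / e + R) = q * (R * g / e + R) + q * (g / e) := by ring
  have p1 : 0 ≤ q * R := by positivity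
  have p2 : 0 ≤ q * (g / e) := by positivity
  rw [abs_le]
  constructor <;> linarith
end

section
/- Let A ∈ ℝ^{m×n}, b ∈ ℝ^m, c ∈ ℝ^n and Â ∈ ℝ^{k×ℓ}, b̂ ∈ ℝ^k, ĉ ∈ ℝ^ℓ. Suppose there exist matrices U ∈ ℝ^{k×m} and V ∈ ℝ^{ℓ×n} with all entries nonnegative such that U·A = Â·V, A·Vᵀ = Uᵀ·Â, U·b = b̂, Uᵀ·b̂ = b, cᵀ·Vᵀ = ĉᵀ, and ĉᵀ·V = cᵀ. Then the two linear programs have equal optimal values: OPT(A,b,c) = OPT(Â,b̂,ĉ), as an equality of suprema in ℝ ∪ {−∞, +∞}. -/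
open Matrix BigOperators

theorem lp_le_aux {m n k l : ℕ}
    (A : Matrix (Fin m) (Fin n) ℝ) (b : Fin m → ℝ) (c : Fin n → ℝ)
    (Ahat : Matrix (Fin k) (Fin l) ℝ) (bhat : Fin k → ℝ) (chat : Fin l → ℝ)
    (U : Matrix (Fin k) (Fin m) ℝ) (V : Matrix (Fin l) (Fin n) ℝ)
    (hU : ∀ r i, 0 ≤ U r i) (hV : ∀ s j, 0 ≤ V s j)
    (h1 : U * A = Ahat * V)
    (h3 : U.mulVec b = bhat)
    (h6 : Vᵀ.mulVec chat = c) :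
    lpOPT A b c ≤ lpOPT Ahat bhat chat := by
  unfold lpOPT
  apply sSup_le_sSup
  rintro _ ⟨x, ⟨hx, hx0⟩, rfl⟩
  refine ⟨V.mulVec x, ⟨fun r => ?_, fun s => ?_⟩, ?_⟩
  · rw [Matrix.mulVec_mulVec, ← h1, ← Matrix.mulVec_mulVec, ← h3]
    change ∑ i, U r i * (A *ᵥ x) i ≤ ∑ i, U r i * b i
    exact Finset.sum_le_sum fun i _ => mul_le_mul_of_nonneg_left (hx i) (hU r i)
  · change 0 ≤ ∑ j, V s j * x j
    exact Finset.sum_nonneg fun j _ => mul_nonneg (hV s j) (hx0 j)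
  · simp only []
    rw [Matrix.dotProduct_mulVec, ← h6, Matrix.mulVec_transpose]

/-- If nonnegative matrices `U, V` form a (two-sided) fractional isomorphism between
the LP `(A, b, c)` and the LP `(Â, b̂, ĉ)`, i.e. `U·A = Â·V`, `A·Vᵀ = Uᵀ·Â`,
`U·b = b̂`, `Uᵀ·b̂ = b`, `cᵀ·Vᵀ = ĉᵀ` and `ĉᵀ·V = cᵀ`, then the two LPs have the
same optimal value (as an equality in `ℝ ∪ {-∞, +∞}`). -/
theorem lp_fractional_isomorphism_opt_eq {m n k l : ℕ}
    (A : Matrix (Fin m) (Fin n) ℝ) (b : Fin m → ℝ) (c : Fin n → ℝ)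
    (Ahat : Matrix (Fin k) (Fin l) ℝ) (bhat : Fin k → ℝ) (chat : Fin l → ℝ)
    (U : Matrix (Fin k) (Fin m) ℝ) (V : Matrix (Fin l) (Fin n) ℝ)
    (hU : ∀ r i, 0 ≤ U r i) (hV : ∀ s j, 0 ≤ V s j)
    (h1 : U * A = Ahat * V)
    (h2 : A * Vᵀ = Uᵀ * Ahat)
    (h3 : U.mulVec b = bhat)
    (h4 : Uᵀ.mulVec bhat = b)
    (h5 : V.mulVec c = chat)
    (h6 : Vᵀ.mulVec chat = c) :
    lpOPT A b c = lpOPT Ahat bhat chat := by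
  apply le_antisymm
  · exact lp_le_aux A b c Ahat bhat chat U V hU hV h1 h3 h6
  · exact lp_le_aux Ahat bhat chat A b c Uᵀ Vᵀ (fun r i => hU i r) (fun s j => hV j s)
      h2.symm h4 (by rw [Matrix.transpose_transpose]; exact h5)
end

section
/- Let A ∈ ℝ^{m×n}, b ∈ ℝ^m, c ∈ ℝ^n define a well-behaved linear program. Then there exist q₀ > 0 and a constant K ≥ 0 such that for all u ∈ ℝ^m and v ∈ ℝ^n with ‖u‖_∞ ≤ q₀ and ‖v‖_∞ ≤ q₀, one has |OPT(A, b+u, c+v) − OPT(A, b, c)| ≤ K·(‖u‖_∞ + ‖v‖_∞). -/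
open Matrix BigOperators

theorem conv_lip {k : ℕ} (g : (Fin k → ℝ) → ℝ) (ε L U : ℝ) (hε : 0 < ε)
    (hL : ∀ v, ‖v‖ ≤ ε → L ≤ g v) (hU : ∀ v, ‖v‖ ≤ ε → g v ≤ U)
    (hc : ∀ v w, ‖v‖ ≤ ε → ‖w‖ ≤ ε → ∀ a b : ℝ, 0 ≤ a → 0 ≤ b → a + b = 1 →
      g (a • v + b • w) ≤ a * g v + b * g w) (v : Fin k → ℝ) (hv : ‖v‖ ≤ ε) :
    |g v - g 0| ≤ (U - L) / ε * ‖v‖ := by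
  have h00 : ‖(0 : Fin k → ℝ)‖ ≤ ε := by simpa using hε.le
  rcases eq_or_ne v 0 with rfl | hv0
  · simp
  have hp : 0 < ‖v‖ := norm_pos_iff.mpr hv0
  obtain ⟨s, hs⟩ : ∃ s, s = ‖v‖ / ε := ⟨_, rfl⟩
  have hs0 : 0 < s := by rw [hs]; positivity
  have hs1 : s ≤ 1 := by rw [hs]; exact (div_le_one hε).mpr hv
  obtain ⟨w, hw⟩ : ∃ w, w = s⁻¹ • v := ⟨_, rfl⟩
  have hwn : ‖w‖ ≤ ε := by
    rw [hw, norm_smul, Real.norm_of_nonneg (by positivity), hs]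
    apply le_of_eq; field_simp
  have hvw : v = s • w := by rw [hw, smul_smul, mul_inv_cancel₀ hs0.ne', one_smul]
  have h1 := hc 0 w h00 hwn (1 - s) s (by linarith) hs0.le (by ring)
  rw [smul_zero, zero_add, ← hvw] at h1
  have hwn' : ‖-w‖ ≤ ε := by rwa [norm_neg]
  have h2 := hc v (-w) hv hwn' (1 / (1 + s)) (s / (1 + s)) (by positivity) (by positivity)
    (by field_simp)
  have e0 : (1 / (1 + s)) • v + (s / (1 + s)) • (-w) = 0 := by
    rw [hvw, smul_smul, smul_neg, ← sub_eq_add_neg, ← sub_smul]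
    have : 1 / (1 + s) * s - s / (1 + s) = 0 := by ring
    rw [this, zero_smul]
  rw [e0] at h2
  have h3 : (1 + s) * g 0 ≤ g v + s * g (-w) := by
    have := mul_le_mul_of_nonneg_left h2 (show 0 ≤ 1 + s by linarith)
    have e : (1 + s) * (1 / (1 + s) * g v + s / (1 + s) * g (-w)) = g v + s * g (-w) := by
      field_simp
    linarith
  have e : (U - L) / ε * ‖v‖ = s * (U - L) := by rw [hs]; ring
  rw [e, abs_le]
  have := hL 0 h00
  have a1 := mul_le_mul_of_nonneg_left (hL 0 h00) hs0.le
  have a2 := mul_le_mul_of_nonneg_left (hU w hwn) hs0.le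
  have a3 := mul_le_mul_of_nonneg_left (hU (-w) hwn') hs0.le
  constructor <;> nlinarith

/-- For a well-behaved LP, the optimal value is Lipschitz continuous in `(b, c)`
in a small enough neighborhood: there are `q₀ > 0` and `K ≥ 0` such that whenever
`‖u‖_∞ ≤ q₀` and `‖v‖_∞ ≤ q₀`,
`|OPT(A, b+u, c+v) − OPT(A, b, c)| ≤ K·(‖u‖_∞ + ‖v‖_∞)`. -/
theorem lp_opt_lipschitz {m n : ℕ} (A : Matrix (Fin m) (Fin n) ℝ)
    (b : Fin m → ℝ) (c : Fin n → ℝ) (hwb : WellBehaved A b c) :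
    ∃ q₀ > (0 : ℝ), ∃ K ≥ (0 : ℝ), ∀ (u : Fin m → ℝ) (v : Fin n → ℝ),
      ‖u‖ ≤ q₀ → ‖v‖ ≤ q₀ →
      ∃ y y' : ℝ, lpOPT A (b + u) (c + v) = (y : EReal) ∧
        lpOPT A b c = (y' : EReal) ∧ |y - y'| ≤ K * (‖u‖ + ‖v‖) := by
  obtain ⟨ε, hε, H⟩ := hwb
  obtain ⟨F, hF⟩ : ∃ F : (Fin m → ℝ) → (Fin n → ℝ) → ℝ,
      ∀ u v, ‖u‖ ≤ ε → ‖v‖ ≤ ε → lpOPT A (b + u) (c + v) = (F u v : EReal) := by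
    refine ⟨fun u v => (lpOPT A (b + u) (c + v)).toReal, fun u v hu hv => ?_⟩
    obtain ⟨y, hy⟩ := H u v hu hv
    simp [hy]
  have H1 : ∀ u v, ‖u‖ ≤ ε → ‖v‖ ≤ ε → ∀ x : Fin n → ℝ, (∀ i, A.mulVec x i ≤ (b + u) i) →
      (∀ j, 0 ≤ x j) → (c + v) ⬝ᵥ x ≤ F u v := by
    intro u v hu hv x hx hx0
    have : (((c + v) ⬝ᵥ x : ℝ) : EReal) ≤ lpOPT A (b + u) (c + v) :=
      le_sSup ⟨x, ⟨hx, hx0⟩, rfl⟩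
    rw [hF u v hu hv] at this
    exact_mod_cast this
  have H2 : ∀ u v, ‖u‖ ≤ ε → ‖v‖ ≤ ε → ∀ δ > 0, ∃ x : Fin n → ℝ,
      (∀ i, A.mulVec x i ≤ (b + u) i) ∧ (∀ j, 0 ≤ x j) ∧ F u v - δ < (c + v) ⬝ᵥ x := by
    intro u v hu hv δ hδ
    have : ((F u v - δ : ℝ) : EReal) < lpOPT A (b + u) (c + v) := by
      rw [hF u v hu hv]; exact_mod_cast (by linarith)
    obtain ⟨_, ⟨x, ⟨hx, hx0⟩, rfl⟩, h⟩ := lt_sSup_iff.mp this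
    exact ⟨x, hx, hx0, EReal.coe_lt_coe_iff.mp h⟩
  have mono : ∀ u v u' v', ‖u‖ ≤ ε → ‖v‖ ≤ ε → ‖u'‖ ≤ ε → ‖v'‖ ≤ ε → (∀ i, u i ≤ u' i) →
      (∀ j, v j ≤ v' j) → F u v ≤ F u' v' := by
    intro u v u' v' hu hv hu' hv' huu hvv
    refine le_of_forall_pos_le_add fun δ hδ => ?_
    obtain ⟨x, hx, hx0, h⟩ := H2 u v hu hv δ hδ
    have h1 := H1 u' v' hu' hv' x (fun i => (hx i).trans (by simpa using huu i)) hx0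
    have h2 : (c + v) ⬝ᵥ x ≤ (c + v') ⬝ᵥ x :=
      Finset.sum_le_sum fun j _ => mul_le_mul_of_nonneg_right (by simpa using hvv j) (hx0 j)
    linarith
  have hne : ∀ k : ℕ, ∀ t : ℝ, |t| = ε → ‖(fun _ : Fin k => t)‖ ≤ ε := fun k t ht =>
    (pi_norm_le_iff_of_nonneg hε.le).mpr fun i => by rw [Real.norm_eq_abs, ht]
  have hE : |ε| = ε := abs_of_pos hε
  have hE' : |-ε| = ε := by rw [abs_neg, hE]
  have hcoord : ∀ k : ℕ, ∀ u : Fin k → ℝ, ‖u‖ ≤ ε → ∀ i, -ε ≤ u i ∧ u i ≤ ε :=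
    fun k u hu i => abs_le.mp ((norm_le_pi_norm u i).trans hu)
  obtain ⟨U, hU⟩ : ∃ U, ∀ u v, ‖u‖ ≤ ε → ‖v‖ ≤ ε → F u v ≤ U :=
    ⟨F (fun _ => ε) (fun _ => ε), fun u v hu hv => mono _ _ _ _ hu hv (hne _ _ hE) (hne _ _ hE)
      (fun i => (hcoord _ u hu i).2) (fun i => (hcoord _ v hv i).2)⟩
  obtain ⟨L, hL⟩ : ∃ L, ∀ u v, ‖u‖ ≤ ε → ‖v‖ ≤ ε → L ≤ F u v :=
    ⟨F (fun _ => -ε) (fun _ => -ε), fun u v hu hv => mono _ _ _ _ (hne _ _ hE') (hne _ _ hE')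
      hu hv (fun i => (hcoord _ u hu i).1) (fun i => (hcoord _ v hv i).1)⟩
  have hball : ∀ k : ℕ, ∀ v w : Fin k → ℝ, ‖v‖ ≤ ε → ‖w‖ ≤ ε → ∀ a b : ℝ, 0 ≤ a → 0 ≤ b →
      a + b = 1 → ‖a • v + b • w‖ ≤ ε := by
    intro k v w hv hw a b ha hb hab
    refine (norm_add_le _ _).trans ?_
    rw [norm_smul, norm_smul, Real.norm_of_nonneg ha, Real.norm_of_nonneg hb]
    have := mul_le_mul_of_nonneg_left hv ha
    have := mul_le_mul_of_nonneg_left hw hb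
    have : a * ε + b * ε = ε := by rw [← add_mul, hab, one_mul]
    linarith
  have h0m : ‖(0 : Fin m → ℝ)‖ ≤ ε := by simpa using hε.le
  have h0n : ‖(0 : Fin n → ℝ)‖ ≤ ε := by simpa using hε.le
  have hLU : L ≤ U := (hL 0 0 h0m h0n).trans (hU 0 0 h0m h0n)
  refine ⟨ε, hε, (U - L) / ε, div_nonneg (by linarith) hε.le, fun u v hu hv =>
    ⟨F u v, F 0 0, hF u v hu hv, by simpa using hF 0 0 h0m h0n, ?_⟩⟩
  have hV := conv_lip (fun v => F u v) ε L U hε (fun v hv => hL u v hu hv)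
    (fun v hv => hU u v hu hv) (by
      intro v w hv hw s t hs ht hst
      refine le_of_forall_pos_le_add fun δ hδ => ?_
      obtain ⟨x, hx, hx0, h⟩ := H2 u _ hu (hball _ v w hv hw s t hs ht hst) δ hδ
      have h1 := mul_le_mul_of_nonneg_left (H1 u v hu hv x hx hx0) hs
      have h2 := mul_le_mul_of_nonneg_left (H1 u w hu hw x hx hx0) ht
      have e : (c + (s • v + t • w)) ⬝ᵥ x = s * ((c + v) ⬝ᵥ x) + t * ((c + w) ⬝ᵥ x) := by
        simp only [add_dotProduct, smul_dotProduct, smul_eq_mul]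
        linear_combination (-(c ⬝ᵥ x)) * hst
      show F u (s • v + t • w) ≤ s * F u v + t * F u w + δ
      linarith) v hv
  have hW := conv_lip (fun u => - F u 0) ε (-U) (-L) hε
    (fun u hu => neg_le_neg (hU u 0 hu h0n))
    (fun u hu => neg_le_neg (hL u 0 hu h0n)) (by
      intro v w hv hw s t hs ht hst
      refine le_of_forall_pos_le_add fun δ hδ => ?_
      obtain ⟨x, hx, hx0, h⟩ := H2 v 0 hv h0n δ hδ
      obtain ⟨z, hz, hz0, h'⟩ := H2 w 0 hw h0n δ hδ
      have h1 := H1 _ 0 (hball _ v w hv hw s t hs ht hst) h0n (s • x + t • z) (by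
        intro i
        have h1 := mul_le_mul_of_nonneg_left (hx i) hs
        have h2 := mul_le_mul_of_nonneg_left (hz i) ht
        simp only [mulVec_add, mulVec_smul, Pi.add_apply, Pi.smul_apply, smul_eq_mul] at *
        have : s * b i + t * b i = b i := by rw [← add_mul, hst, one_mul]
        linarith) (fun j => add_nonneg (mul_nonneg hs (hx0 j)) (mul_nonneg ht (hz0 j)))
      simp only [dotProduct_add, dotProduct_smul, smul_eq_mul] at h1
      have h2 := mul_le_mul_of_nonneg_left h.le hs
      have h3 := mul_le_mul_of_nonneg_left h'.le ht
      have : s * δ + t * δ = δ := by rw [← add_mul, hst, one_mul]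
      show - F (s • v + t • w) 0 ≤ s * -F v 0 + t * -F w 0 + δ
      linarith) u hu
  have e : (-L - -U) / ε = (U - L) / ε := by ring
  rw [e] at hW
  have e2 : F u v - F 0 0 = (F u v - F u 0) - (-F u 0 - -F 0 0) := by ring
  rw [e2, mul_add]
  refine (abs_sub _ _).trans ?_
  linarith
end

section
/- Consider a network flow problem G = (X, c, {s}, {t}) with a single source s and single target t, s ≠ t, and let P = {P_0, P_1, …, P_{k−1}, P_k} be any partition of X with P_0 = {s} and P_k = {t}. Define two capacity functions on the node set {0,1,…,k}: ĉ₁(i,j) := maxUFlow(P_i, P_j, c) (the maximum value of a uniform flow in the bipartite graph with parts P_i, P_j and capacities c restricted to P_i × P_j) and ĉ₂(i,j) := c(P_i, P_j), and let Ĝ₁, Ĝ₂ be the networks on {0,…,k} with source {0}, target {k}, and capacities ĉ₁, ĉ₂ respectively. Then maxFlow(Ĝ₁) ≤ maxFlow(G) ≤ maxFlow(Ĝ₂). -/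
open BigOperators

/-- `f` is a flow in the network with capacities `c`, sources `S` and targets `T`:
`f` is nonnegative, respects capacities, and is conserved at every non-terminal node. -/
def IsFlow {X : Type*} [Fintype X] (c : X → X → ℝ) (S T : Finset X)
    (f : X → X → ℝ) : Prop :=
  (∀ x y, 0 ≤ f x y) ∧ (∀ x y, f x y ≤ c x y) ∧
    ∀ z, z ∉ S → z ∉ T → (∑ x, f x z) = (∑ x, f z x)

/-- The value of a flow: total flow out of the sources. -/
def flowValue {X : Type*} [Fintype X] (S : Finset X) (f : X → X → ℝ) : ℝ :=
  ∑ x ∈ S, ∑ y, f x y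

/-- The maximum value of a flow in the network `(X, c, S, T)`. -/
noncomputable def maxFlow {X : Type*} [Fintype X] (c : X → X → ℝ)
    (S T : Finset X) : ℝ :=
  sSup {v | ∃ f, IsFlow c S T f ∧ flowValue S f = v}

/-- `f` is a uniform flow in the bipartite graph with parts `A`, `B` and
capacities `c` restricted to `A × B`: all sources have the same outgoing flow
and all targets have the same incoming flow. -/
def IsUniformFlow {X : Type*} [Fintype X] (c : X → X → ℝ) (A B : Finset X)
    (f : X → X → ℝ) : Prop :=
  (∀ x y, 0 ≤ f x y) ∧ (∀ x ∈ A, ∀ y ∈ B, f x y ≤ c x y) ∧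
    (∀ x₁ ∈ A, ∀ x₂ ∈ A, (∑ y ∈ B, f x₁ y) = (∑ y ∈ B, f x₂ y)) ∧
    (∀ y₁ ∈ B, ∀ y₂ ∈ B, (∑ x ∈ A, f x y₁) = (∑ x ∈ A, f x y₂))

/-- The maximum value of a uniform flow in the bipartite graph `(A, B, c)`. -/
noncomputable def maxUFlow {X : Type*} [Fintype X] (c : X → X → ℝ)
    (A B : Finset X) : ℝ :=
  sSup {v | ∃ f, IsUniformFlow c A B f ∧ (∑ x ∈ A, ∑ y ∈ B, f x y) = v}

theorem flowValue_bdd {X : Type*} [Fintype X] (c : X → X → ℝ) (S T : Finset X) :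
    BddAbove {v | ∃ f, IsFlow c S T f ∧ flowValue S f = v} := by
  refine ⟨∑ x ∈ S, ∑ y, c x y, ?_⟩
  rintro v ⟨f, hf, rfl⟩
  exact Finset.sum_le_sum fun x _ => Finset.sum_le_sum fun y _ => hf.2.1 x y

theorem maxFlow_nonneg {X : Type*} [Fintype X] (c : X → X → ℝ) (S T : Finset X) :
    0 ≤ maxFlow c S T := by
  apply Real.sSup_nonneg
  rintro v ⟨f, hf, rfl⟩
  exact Finset.sum_nonneg fun x _ => Finset.sum_nonneg fun y _ => hf.1 x y

theorem exists_uflow {X : Type*} [Fintype X] (c : X → X → ℝ) (hc : ∀ x y, 0 ≤ c x y)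
    (A B : Finset X) (h : ℝ) (h0 : 0 ≤ h) (h1 : h = 0 ∨ h < maxUFlow c A B) :
    ∃ u, IsUniformFlow c A B u ∧ (∑ x ∈ A, ∑ y ∈ B, u x y) = h := by
  have hz : IsUniformFlow c A B (fun _ _ => 0) :=
    ⟨by simp, fun x _ y _ => hc x y, by simp, by simp⟩
  rcases h1 with rfl | h1
  · exact ⟨fun _ _ => 0, hz, by simp⟩
  · have hne : {v | ∃ f, IsUniformFlow c A B f ∧ (∑ x ∈ A, ∑ y ∈ B, f x y) = v}.Nonempty :=
      ⟨_, _, hz, rfl⟩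
    obtain ⟨v, ⟨u, hu, huv⟩, hv⟩ := exists_lt_of_lt_csSup hne h1
    have hvpos : 0 < v := lt_of_le_of_lt h0 hv
    have hr0 : 0 ≤ h / v := by positivity
    have hr1 : h / v ≤ 1 := by rw [div_le_one hvpos]; exact hv.le
    refine ⟨fun x y => h / v * u x y, ⟨?_, ?_, ?_, ?_⟩, ?_⟩
    · intro x y; exact mul_nonneg hr0 (hu.1 x y)
    · intro x hx y hy
      exact (mul_le_of_le_one_left (hu.1 x y) hr1).trans (hu.2.1 x hx y hy)
    · intro x hx y hy
      simp only [← Finset.mul_sum]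
      rw [hu.2.2.1 x hx y hy]
    · intro x hx y hy
      simp only [← Finset.mul_sum]
      rw [hu.2.2.2 x hx y hy]
    · simp only [← Finset.mul_sum]
      rw [huv]; field_simp

/-- For a single-source single-target network `G = (X, c, {s}, {t})` and any
partition `P_0 = {s}, P_1, …, P_{k-1}, P_k = {t}` of the nodes, the reduced
network with capacities `ĉ₁(i,j) = maxUFlow(P_i,P_j,c)` underestimates the
max-flow, and the one with capacities `ĉ₂(i,j) = c(P_i,P_j)` overestimates it:
`maxFlow(Ĝ₁) ≤ maxFlow(G) ≤ maxFlow(Ĝ₂)`. -/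
theorem maxflow_reduced_bounds {X : Type*} [Fintype X] [DecidableEq X]
    (c : X → X → ℝ) (hc : ∀ x y, 0 ≤ c x y)
    (s t : X) (hst : s ≠ t) (k : ℕ)
    (P : Fin (k + 1) → Finset X)
    (hpart : ∀ x : X, ∃! i, x ∈ P i)
    (hP0 : P 0 = {s}) (hPk : P (Fin.last k) = {t}) :
    maxFlow (fun i j : Fin (k + 1) => maxUFlow c (P i) (P j))
        {(0 : Fin (k + 1))} {Fin.last k}
      ≤ maxFlow c {s} {t} ∧
    maxFlow c {s} {t}
      ≤ maxFlow (fun i j : Fin (k + 1) => ∑ x ∈ P i, ∑ y ∈ P j, c x y)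
          {(0 : Fin (k + 1))} {Fin.last k} := by
  classical
  choose p hp hpu using hpart
  have hpP : ∀ i x, x ∈ P i → p x = i := fun i x hx => (hpu x i hx).symm
  have hPf : ∀ i, P i = Finset.univ.filter (fun x => p x = i) := by
    intro i; ext x
    simp only [Finset.mem_filter, Finset.mem_univ, true_and]
    exact ⟨hpP i x, fun h => h ▸ hp x⟩
  have hsum : ∀ φ : X → ℝ, ∑ i, ∑ x ∈ P i, φ x = ∑ x, φ x := by
    intro φ
    simp only [hPf]
    exact Finset.sum_fiberwise _ _ _
  have hps : p s = 0 := hpP 0 s (by simp [hP0])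
  have hne0 : ∀ z, z ≠ s → p z ≠ 0 := by
    intro z hz h
    have := hp z
    rw [h, hP0] at this
    exact hz (by simpa using this)
  have hnek : ∀ z, z ≠ t → p z ≠ Fin.last k := by
    intro z hz h
    have := hp z
    rw [h, hPk] at this
    exact hz (by simpa using this)
  constructor
  · apply Real.sSup_le _ (maxFlow_nonneg _ _ _)
    rintro v ⟨g, ⟨g0, g1, g2⟩, rfl⟩
    have key : ∀ θ : ℝ, 0 ≤ θ → θ < 1 →
        θ * flowValue {(0 : Fin (k+1))} g ≤ maxFlow c {s} {t} := by
      intro θ hθ0 hθ1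
      have hex : ∀ i j, ∃ u, IsUniformFlow c (P i) (P j) u ∧
          (∑ x ∈ P i, ∑ y ∈ P j, u x y) = θ * g i j := by
        intro i j
        apply exists_uflow c hc _ _ _ (mul_nonneg hθ0 (g0 i j))
        rcases (g0 i j).eq_or_lt with h | h
        · left; rw [← h]; simp
        · right
          exact lt_of_lt_of_le (mul_lt_of_lt_one_left h hθ1) (g1 i j)
      choose u hu huv using hex
      have hout : ∀ x, ((P (p x)).card : ℝ) * ∑ y, u (p x) (p y) x y
          = ∑ j, θ * g (p x) j := by
        intro x
        rw [← hsum, Finset.mul_sum]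
        refine Finset.sum_congr rfl fun j _ => ?_
        rw [← huv (p x) j, Finset.sum_congr rfl
          (fun x' hx' => (hu (p x) j).2.2.1 x' hx' x (hp x)), Finset.sum_const, nsmul_eq_mul]
        congr 1
        refine Finset.sum_congr rfl fun y hy => ?_
        rw [hpP j y hy]
      have hin : ∀ y, ((P (p y)).card : ℝ) * ∑ x, u (p x) (p y) x y
          = ∑ j, θ * g j (p y) := by
        intro y
        rw [← hsum, Finset.mul_sum]
        refine Finset.sum_congr rfl fun j _ => ?_
        rw [← huv j (p y), Finset.sum_comm, Finset.sum_congr rfl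
          (fun x' hx' => (hu j (p y)).2.2.2 x' hx' y (hp y)), Finset.sum_const, nsmul_eq_mul]
        congr 1
        refine Finset.sum_congr rfl fun x hx => ?_
        rw [hpP j x hx]
      refine le_csSup (flowValue_bdd c {s} {t}) ⟨fun x y => u (p x) (p y) x y, ⟨?_, ?_, ?_⟩, ?_⟩
      · intro x y; exact (hu _ _).1 x y
      · intro x y; exact (hu _ _).2.1 x (hp x) y (hp y)
      · intro z hzs hzt
        have hcard : ((P (p z)).card : ℝ) ≠ 0 := by
          have := Finset.card_pos.2 ⟨z, hp z⟩
          positivity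
        apply mul_left_cancel₀ hcard
        rw [hout z]
        refine (hin z).trans ?_
        rw [← Finset.mul_sum, ← Finset.mul_sum,
          g2 (p z) (by simpa using hne0 z (by simpa using hzs))
            (by simpa using hnek z (by simpa using hzt))]
      · have := hout s
        rw [hps, hP0] at this
        simp only [Finset.card_singleton, Nat.cast_one, one_mul] at this
        simp only [flowValue, Finset.sum_singleton, hps, this, Finset.mul_sum]
    by_contra hcon
    push Not at hcon
    have hM := maxFlow_nonneg c {s} {t}
    set V := flowValue {(0 : Fin (k+1))} g
    set M := maxFlow c {s} {t}
    have hV : 0 < V := lt_of_le_of_lt hM hcon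
    have := key ((M + V) / (2 * V)) (by positivity) (by rw [div_lt_one (by positivity)]; linarith)
    have h2 : (M + V) / (2 * V) * V = (M + V) / 2 := by field_simp
    linarith
  · apply Real.sSup_le _ (maxFlow_nonneg _ _ _)
    rintro v ⟨f, ⟨f0, f1, f2⟩, rfl⟩
    refine le_csSup (flowValue_bdd _ _ _)
      ⟨fun i j => ∑ x ∈ P i, ∑ y ∈ P j, f x y, ⟨?_, ?_, ?_⟩, ?_⟩
    · intro i j
      exact Finset.sum_nonneg fun x _ => Finset.sum_nonneg fun y _ => f0 x y
    · intro i j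
      exact Finset.sum_le_sum fun x _ => Finset.sum_le_sum fun y _ => f1 x y
    · intro i hi0 hik
      have e1 : ∑ j, ∑ x ∈ P j, ∑ y ∈ P i, f x y = ∑ y ∈ P i, ∑ x, f x y := by
        rw [hsum (fun x => ∑ y ∈ P i, f x y), Finset.sum_comm]
      have e2 : ∑ j, ∑ x ∈ P i, ∑ y ∈ P j, f x y = ∑ x ∈ P i, ∑ y, f x y := by
        rw [Finset.sum_comm]
        exact Finset.sum_congr rfl fun x _ => hsum _
      refine e1.trans (Eq.trans ?_ e2.symm)
      refine Finset.sum_congr rfl fun z hz => ?_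
      have hpz := hpP i z hz
      apply f2 z
      · intro h
        have : z = s := by simpa using h
        subst this
        exact hi0 (by simp [← hpz, hps])
      · intro h
        have : z = t := by simpa using h
        subst this
        have : p z = Fin.last k := hpP _ z (by simp [hPk])
        exact hik (by simp [← hpz, this])
    · simp only [flowValue, Finset.sum_singleton, hP0]
      exact hsum _
end

section
/- Consider a network flow problem G = (X, c, {s}, {t}) with a single source s and single target t, s ≠ t, and let P = {P_0, P_1, …, P_k} be any partition of X with P_0 = {s} and P_k = {t}. Let Ĝ₁ be the network on node set {0,…,k} with source {0}, target {k}, and capacities ĉ₁(i,j) := maxUFlow(P_i, P_j, c). Then for every flow f̂ in Ĝ₁ there exists a flow f in G with value(f) = value(f̂). -/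
open BigOperators

lemma isUniformFlow_values_compact {X : Type*} [Fintype X] [DecidableEq X]
    (c : X → X → ℝ) (hc : ∀ x y, 0 ≤ c x y) (A B : Finset X) :
    IsCompact {v | ∃ f, IsUniformFlow c A B f ∧ (∑ x ∈ A, ∑ y ∈ B, f x y) = v} := by
  have hK : IsCompact {f : X → X → ℝ | IsUniformFlow c A B f ∧ ∀ x y, f x y ≤ c x y} := by
    refine IsCompact.of_isClosed_subset (isCompact_Icc (a := (0 : X → X → ℝ)) (b := c)) ?_ ?_
    · unfold IsUniformFlow
      simp only [Set.setOf_and, Set.setOf_forall]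
      refine IsClosed.inter (IsClosed.inter ?_ (IsClosed.inter ?_ (IsClosed.inter ?_ ?_))) ?_
      · exact isClosed_iInter fun x => isClosed_iInter fun y =>
          isClosed_le (by fun_prop) (by fun_prop)
      · exact isClosed_iInter fun x => isClosed_iInter fun _ => isClosed_iInter fun y =>
          isClosed_iInter fun _ => isClosed_le (by fun_prop) (by fun_prop)
      · exact isClosed_iInter fun x => isClosed_iInter fun _ => isClosed_iInter fun y =>
          isClosed_iInter fun _ => isClosed_eq (by fun_prop) (by fun_prop)
      · exact isClosed_iInter fun x => isClosed_iInter fun _ => isClosed_iInter fun y =>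
          isClosed_iInter fun _ => isClosed_eq (by fun_prop) (by fun_prop)
      · exact isClosed_iInter fun x => isClosed_iInter fun y =>
          isClosed_le (by fun_prop) (by fun_prop)
    · rintro f ⟨hf, hfc⟩
      exact ⟨fun x y => hf.1 x y, fun x y => hfc x y⟩
  have him := hK.image (f := fun f : X → X → ℝ => ∑ x ∈ A, ∑ y ∈ B, f x y) (by fun_prop)
  convert him using 1
  ext v
  constructor
  · rintro ⟨f, hf, rfl⟩
    have hrow : ∀ x ∈ A, ∑ y ∈ B, (if x ∈ A ∧ y ∈ B then f x y else 0) = ∑ y ∈ B, f x y :=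
      fun x hx => Finset.sum_congr rfl fun y hy => by simp [hx, hy]
    have hcol : ∀ y ∈ B, ∑ x ∈ A, (if x ∈ A ∧ y ∈ B then f x y else 0) = ∑ x ∈ A, f x y :=
      fun y hy => Finset.sum_congr rfl fun x hx => by simp [hx, hy]
    refine ⟨fun x y => if x ∈ A ∧ y ∈ B then f x y else 0, ⟨⟨?_, ?_, ?_, ?_⟩, ?_⟩, ?_⟩
    · intro x y
      dsimp only
      split_ifs
      · exact hf.1 x y
      · exact le_rfl
    · intro x hx y hy
      simpa [hx, hy] using hf.2.1 x hx y hy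
    · intro x hx y hy
      simp only [hrow x hx, hrow y hy]
      exact hf.2.2.1 x hx y hy
    · intro x hx y hy
      simp only [hcol x hx, hcol y hy]
      exact hf.2.2.2 x hx y hy
    · intro x y
      dsimp only
      split_ifs with h
      · exact hf.2.1 x h.1 y h.2
      · exact hc x y
    · exact Finset.sum_congr rfl hrow
  · rintro ⟨f, hf, rfl⟩
    exact ⟨f, hf.1, rfl⟩

lemma exists_uniformFlow_of_le {X : Type*} [Fintype X] [DecidableEq X]
    (c : X → X → ℝ) (hc : ∀ x y, 0 ≤ c x y) (A B : Finset X) (v : ℝ) (hv : 0 ≤ v)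
    (hvm : v ≤ maxUFlow c A B) :
    ∃ f, IsUniformFlow c A B f ∧ (∀ x ∈ A, (A.card : ℝ) * ∑ y ∈ B, f x y = v) ∧
      (∀ y ∈ B, (B.card : ℝ) * ∑ x ∈ A, f x y = v) := by
  suffices h : ∃ f, IsUniformFlow c A B f ∧ (∑ x ∈ A, ∑ y ∈ B, f x y) = v by
    obtain ⟨f, hf, hfv⟩ := h
    refine ⟨f, hf, fun x hx => ?_, fun y hy => ?_⟩
    · rw [← hfv, Finset.sum_congr rfl fun z hz => hf.2.2.1 z hz x hx]
      simp
    · rw [← hfv, Finset.sum_comm, Finset.sum_congr rfl fun z hz => hf.2.2.2 z hz y hy]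
      simp
  have hz : IsUniformFlow c A B (fun _ _ => 0) :=
    ⟨fun _ _ => le_rfl, fun x _ y _ => hc x y, fun _ _ _ _ => rfl, fun _ _ _ _ => rfl⟩
  obtain ⟨f, hf, hfm⟩ := (isUniformFlow_values_compact c hc A B).sSup_mem ⟨0, _, hz, by simp⟩
  change _ = maxUFlow c A B at hfm
  rcases (hv.trans hvm).eq_or_lt with h0 | h0
  · exact ⟨_, hz, by simp; linarith⟩
  · have hr0 : 0 ≤ v / maxUFlow c A B := by positivity
    have hr1 : v / maxUFlow c A B ≤ 1 := (div_le_one h0).2 hvm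
    refine ⟨fun x y => v / maxUFlow c A B * f x y, ⟨?_, ?_, ?_, ?_⟩, ?_⟩
    · exact fun x y => mul_nonneg hr0 (hf.1 x y)
    · exact fun x hx y hy =>
        (mul_le_of_le_one_left (hf.1 x y) hr1).trans (hf.2.1 x hx y hy)
    · intro x hx y hy
      simp only [← Finset.mul_sum, hf.2.2.1 x hx y hy]
    · intro x hx y hy
      simp only [← Finset.mul_sum, hf.2.2.2 x hx y hy]
    · simp only [← Finset.mul_sum, hfm]
      field_simp

/-- For a single-source single-target network `G = (X, c, {s}, {t})` and any
partition `P_0 = {s}, P_1, …, P_k = {t}` of the nodes, every flow `f̂` in the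
reduced network `Ĝ₁` with capacities `ĉ₁(i,j) = maxUFlow(P_i,P_j,c)` can be
lifted to a flow `f` in `G` with the same value. -/
theorem reduced_flow_lifts {X : Type*} [Fintype X] [DecidableEq X]
    (c : X → X → ℝ) (hc : ∀ x y, 0 ≤ c x y)
    (s t : X) (hst : s ≠ t) (k : ℕ)
    (P : Fin (k + 1) → Finset X)
    (hpart : ∀ x : X, ∃! i, x ∈ P i)
    (hP0 : P 0 = {s}) (hPk : P (Fin.last k) = {t}) :
    ∀ fhat : Fin (k + 1) → Fin (k + 1) → ℝ,
      IsFlow (fun i j => maxUFlow c (P i) (P j))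
        {(0 : Fin (k + 1))} {Fin.last k} fhat →
      ∃ f : X → X → ℝ, IsFlow c {s} {t} f ∧
        flowValue {s} f = flowValue {(0 : Fin (k + 1))} fhat := by
  intro fhat hfh
  obtain ⟨h0, hle, hcons⟩ := hfh
  choose g hg hgr hgc using fun i j =>
    exists_uniformFlow_of_le c hc (P i) (P j) (fhat i j) (h0 i j) (hle i j)
  choose idx hidx huniq using hpart
  have hmem : ∀ x i, x ∈ P i ↔ idx x = i := fun x i =>
    ⟨fun h => (huniq x i h).symm, fun h => h ▸ hidx x⟩
  have hP : ∀ i, P i = Finset.univ.filter (fun x => idx x = i) := fun i => by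
    ext x; simp [hmem]
  have hsum : ∀ h : X → ℝ, ∑ x, h x = ∑ i, ∑ x ∈ P i, h x := fun h => by
    simp only [hP]
    exact (Finset.sum_fiberwise Finset.univ idx h).symm
  have hout : ∀ z, ((P (idx z)).card : ℝ) * ∑ y, g (idx z) (idx y) z y
      = ∑ j, fhat (idx z) j := fun z => by
    rw [hsum, Finset.mul_sum]
    refine Finset.sum_congr rfl fun j _ => ?_
    rw [← hgr (idx z) j z (hidx z)]
    congr 1
    refine Finset.sum_congr rfl fun y hy => ?_
    rw [(hmem y j).1 hy]
  have hin : ∀ z, ((P (idx z)).card : ℝ) * ∑ x, g (idx x) (idx z) x z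
      = ∑ i, fhat i (idx z) := fun z => by
    rw [hsum, Finset.mul_sum]
    refine Finset.sum_congr rfl fun j _ => ?_
    rw [← hgc j (idx z) z (hidx z)]
    congr 1
    refine Finset.sum_congr rfl fun y hy => ?_
    rw [(hmem y j).1 hy]
  refine ⟨fun x y => g (idx x) (idx y) x y, ⟨fun x y => (hg _ _).1 x y,
    fun x y => (hg _ _).2.1 x (hidx x) y (hidx y), ?_⟩, ?_⟩
  · intro z hzs hzt
    have hne : ((P (idx z)).card : ℝ) ≠ 0 := by
      exact_mod_cast Finset.card_ne_zero_of_mem (hidx z)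
    apply mul_left_cancel₀ hne
    rw [hin, hout]
    apply hcons
    · intro h
      rw [Finset.mem_singleton] at h
      exact hzs (hP0 ▸ (hmem z 0).2 h)
    · intro h
      rw [Finset.mem_singleton] at h
      exact hzt (hPk ▸ (hmem z _).2 h)
  · have hs : idx s = 0 := (hmem s 0).1 (by simp [hP0])
    have := hout s
    rw [hs, hP0] at this
    simpa [flowValue, hs] using this
end

section
/- Let G = (X, Y, c) be a weighted bipartite graph with nonempty finite parts X, Y and capacities c(x,y) ≥ 0. Let a, b > 0 be such that c(x,Y) ≥ a for all x ∈ X and c(X,y) ≥ b for all y ∈ Y, and set F := min(a·|X|, b·|Y|). Assume that for all subsets S ⊆ X and T ⊆ Y, c(S,T) + F ≥ a·|S| + b·|T|. Then G admits a uniform flow of value F; in particular maxUFlow(G) ≥ F. -/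
open BigOperators

/-- `f` is a uniform flow in the weighted bipartite graph `(X, Y, c)`:
`f` is nonnegative, respects capacities, all source nodes have the same
outgoing flow, and all target nodes have the same incoming flow. -/
def IsUniformFlowB {X Y : Type*} [Fintype X] [Fintype Y]
    (c : X → Y → ℝ) (f : X → Y → ℝ) : Prop :=
  (∀ x y, 0 ≤ f x y) ∧ (∀ x y, f x y ≤ c x y) ∧
    (∀ x₁ x₂ : X, (∑ y, f x₁ y) = (∑ y, f x₂ y)) ∧
    (∀ y₁ y₂ : Y, (∑ x, f x y₁) = (∑ x, f x y₂))

/-- The maximum value of a uniform flow in the bipartite graph `(X, Y, c)`. -/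
noncomputable def maxUFlowB {X Y : Type*} [Fintype X] [Fintype Y]
    (c : X → Y → ℝ) : ℝ :=
  sSup {v | ∃ f, IsUniformFlowB c f ∧ (∑ x, ∑ y, f x y) = v}

lemma flow_feas {X Y : Type*} [Fintype X] [Fintype Y]
    (c : X → Y → ℝ) (hc : ∀ x y, 0 ≤ c x y) (a b F : ℝ)
    (hX : a * (Fintype.card X : ℝ) = F) (hY : b * (Fintype.card Y : ℝ) = F)
    (hm : ∀ (S : Finset X) (T : Finset Y),
      a * (S.card : ℝ) + b * (T.card : ℝ) ≤ (∑ x ∈ S, ∑ y ∈ T, c x y) + F) :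
    ∃ f : X → Y → ℝ, (∀ x y, 0 ≤ f x y) ∧ (∀ x y, f x y ≤ c x y) ∧
      (∀ x, ∑ y, f x y = a) ∧ (∀ y, ∑ x, f x y = b) := by
  classical
  let Φ : (X → Y → ℝ) → ℝ := fun f =>
    ∑ x, (a - ∑ y, f x y) ^ 2 + ∑ y, (b - ∑ x, f x y) ^ 2
  have hΦ : Continuous Φ := by fun_prop
  obtain ⟨f, hf, hmin⟩ := (isCompact_Icc (a := (0 : X → Y → ℝ)) (b := c)).exists_isMinOn
    ⟨0, le_refl _, fun x y => hc x y⟩ hΦ.continuousOn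
  have h0 : ∀ x y, 0 ≤ f x y := fun x y => hf.1 x y
  have h1 : ∀ x y, f x y ≤ c x y := fun x y => hf.2 x y
  obtain ⟨u, hu⟩ : ∃ u : X → ℝ, ∀ x, u x = a - ∑ y, f x y := ⟨_, fun _ => rfl⟩
  obtain ⟨v, hv⟩ : ∃ v : Y → ℝ, ∀ y, v y = b - ∑ x, f x y := ⟨_, fun _ => rfl⟩
  have key : ∀ x0 y0 δ, 0 ≤ f x0 y0 + δ → f x0 y0 + δ ≤ c x0 y0 →
      δ * (u x0 + v y0) ≤ δ ^ 2 := by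
    intro x0 y0 δ hd0 hd1
    let g : X → Y → ℝ := fun x y => f x y + if x = x0 then (if y = y0 then δ else 0) else 0
    have hg : g ∈ Set.Icc (0 : X → Y → ℝ) c := by
      constructor
      · intro x y
        simp only [g, Pi.zero_apply]
        split_ifs with hx hy
        · subst hx hy; exact hd0
        · simpa using h0 x y
        · simpa using h0 x y
      · intro x y
        simp only [g]
        split_ifs with hx hy
        · subst hx hy; exact hd1
        · simpa using h1 x y
        · simpa using h1 x y
    have hle : Φ f ≤ Φ g := hmin hg
    have hr : ∀ x, (a - ∑ y, g x y) ^ 2 = u x ^ 2 + if x = x0 then δ ^ 2 - 2 * δ * u x else 0 := by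
      intro x
      have : ∑ y, g x y = ∑ y, f x y + if x = x0 then δ else 0 := by
        simp only [g, Finset.sum_add_distrib]
        split_ifs <;> simp
      rw [this, hu]
      split_ifs <;> ring
    have hcl : ∀ y, (b - ∑ x, g x y) ^ 2 = v y ^ 2 + if y = y0 then δ ^ 2 - 2 * δ * v y else 0 := by
      intro y
      have : ∑ x, g x y = ∑ x, f x y + if y = y0 then δ else 0 := by
        simp only [g, Finset.sum_add_distrib]
        simp
      rw [this, hv]
      split_ifs <;> ring
    have e1 : Φ g = ∑ x, u x ^ 2 + (δ ^ 2 - 2 * δ * u x0)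
        + (∑ y, v y ^ 2 + (δ ^ 2 - 2 * δ * v y0)) := by
      simp only [Φ, hr, hcl, Finset.sum_add_distrib]
      simp
    have e2 : Φ f = ∑ x, u x ^ 2 + ∑ y, v y ^ 2 := by
      simp only [Φ, hu, hv]
    linarith
  have kpos : ∀ x y, 0 < u x + v y → f x y = c x y := by
    intro x y h
    by_contra hne
    have hlt : f x y < c x y := lt_of_le_of_ne (h1 x y) hne
    have hd : 0 < min (c x y - f x y) ((u x + v y) / 2) := lt_min (by linarith) (by linarith)
    have l1 := min_le_left (c x y - f x y) ((u x + v y) / 2)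
    have l2 := min_le_right (c x y - f x y) ((u x + v y) / 2)
    have := key x y _ (by linarith [h0 x y]) (by linarith)
    nlinarith
  have kneg : ∀ x y, u x + v y < 0 → f x y = 0 := by
    intro x y h
    by_contra hne
    have hlt : 0 < f x y := lt_of_le_of_ne (h0 x y) (Ne.symm hne)
    have hd : 0 < min (f x y) (-(u x + v y) / 2) := lt_min (by linarith) (by linarith)
    have l1 := min_le_left (f x y) (-(u x + v y) / 2)
    have l2 := min_le_right (f x y) (-(u x + v y) / 2)
    have := key x y (-min (f x y) (-(u x + v y) / 2)) (by linarith) (by linarith [h1 x y])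
    nlinarith
  let s : X → ℝ := fun x => if 0 < u x then 1 else 0
  let t : Y → ℝ := fun y => if 0 ≤ v y then 1 else 0
  have hpt : ∀ x y, f x y * s x + f x y * t y - f x y = c x y * s x * t y := by
    intro x y
    simp only [s, t]
    split_ifs with p q q
    · rw [kpos x y (by linarith)]; ring
    · ring
    · ring
    · rw [kneg x y (by linarith)]; ring
  have hS := hm (Finset.univ.filter fun x => 0 < u x) (Finset.univ.filter fun y => 0 ≤ v y)
  have c1 : (((Finset.univ.filter fun x => 0 < u x).card : ℕ) : ℝ) = ∑ x, s x := by simp [s]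
  have c2 : (((Finset.univ.filter fun y => 0 ≤ v y).card : ℕ) : ℝ) = ∑ y, t y := by simp [t]
  have c3 : ∑ x ∈ Finset.univ.filter (fun x => 0 < u x), ∑ y ∈ Finset.univ.filter (fun y => 0 ≤ v y),
      c x y = ∑ x, ∑ y, c x y * s x * t y := by
    rw [Finset.sum_filter]
    refine Finset.sum_congr rfl fun x _ => ?_
    rw [Finset.sum_filter]
    simp only [s, t]
    split_ifs <;> simp
  have rowe : ∀ x, ∑ y, f x y = a - u x := fun x => by rw [hu]; ring
  have cole : ∀ y, ∑ x, f x y = b - v y := fun y => by rw [hv]; ring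
  have d1 : ∑ x, ∑ y, f x y * s x = a * ∑ x, s x - ∑ x, u x * s x := by
    simp only [← Finset.sum_mul, rowe, sub_mul, Finset.sum_sub_distrib, Finset.mul_sum]
  have d2 : ∑ x, ∑ y, f x y * t y = b * ∑ y, t y - ∑ y, v y * t y := by
    rw [Finset.sum_comm]
    simp only [← Finset.sum_mul, cole, sub_mul, Finset.sum_sub_distrib, Finset.mul_sum]
  have d3 : ∑ x, ∑ y, f x y = F - ∑ x, u x := by
    simp only [rowe, Finset.sum_sub_distrib, ← hX]
    simp [mul_comm]
  have d4 : ∑ x, ∑ y, f x y = F - ∑ y, v y := by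
    rw [Finset.sum_comm]
    simp only [cole, Finset.sum_sub_distrib, ← hY]
    simp [mul_comm]
  rw [c1, c2, c3] at hS
  simp only [← hpt, Finset.sum_add_distrib, Finset.sum_sub_distrib] at hS
  rw [d1, d2, d3] at hS
  have e0 : ∑ x, u x * (1 - s x) = ∑ x, u x - ∑ x, u x * s x := by
    simp only [mul_sub, mul_one, Finset.sum_sub_distrib]
  have nu : ∀ x, u x * (1 - s x) ≤ 0 := by
    intro x; simp only [s]; split_ifs <;> linarith
  have nv : ∀ y, 0 ≤ v y * t y := by
    intro y; simp only [t]; split_ifs <;> linarith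
  have su : ∑ x, u x * (1 - s x) ≤ 0 := Finset.sum_nonpos fun x _ => nu x
  have sv : 0 ≤ ∑ y, v y * t y := Finset.sum_nonneg fun y _ => nv y
  have su0 : ∑ x, u x * (1 - s x) = 0 := by linarith
  have sv0 : ∑ y, v y * t y = 0 := by linarith
  have up : ∀ x, 0 ≤ u x := by
    intro x
    have := (Finset.sum_eq_zero_iff_of_nonpos fun x _ => nu x).1 su0 x (Finset.mem_univ x)
    simp only [s] at this
    split_ifs at this <;> linarith
  have vn : ∀ y, v y ≤ 0 := by
    intro y
    have := (Finset.sum_eq_zero_iff_of_nonneg fun y _ => nv y).1 sv0 y (Finset.mem_univ y)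
    simp only [t] at this
    split_ifs at this <;> linarith
  have tu : 0 ≤ ∑ x, u x := Finset.sum_nonneg fun x _ => up x
  have tv : ∑ y, v y ≤ 0 := Finset.sum_nonpos fun y _ => vn y
  have tu0 : ∑ x, u x = 0 := by linarith
  have tv0 : ∑ y, v y = 0 := by linarith
  refine ⟨f, h0, h1, fun x => ?_, fun y => ?_⟩
  · have := (Finset.sum_eq_zero_iff_of_nonneg fun x _ => up x).1 tu0 x (Finset.mem_univ x)
    rw [rowe, this, sub_zero]
  · have := (Finset.sum_eq_zero_iff_of_nonpos fun y _ => vn y).1 tv0 y (Finset.mem_univ y)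
    rw [cole, this, sub_zero]

/-- Let `(X, Y, c)` be a weighted bipartite graph with nonempty parts and
nonnegative capacities, `a, b > 0` with `c(x,Y) ≥ a` for all `x` and
`c(X,y) ≥ b` for all `y`, and `F = min(a·|X|, b·|Y|)`. If
`c(S,T) + F ≥ a·|S| + b·|T|` for all `S ⊆ X`, `T ⊆ Y`, then `G` admits a
uniform flow of value `F`; in particular `maxUFlow(G) ≥ F`. -/
theorem uniform_flow_exists {X Y : Type*} [Fintype X] [Fintype Y]
    [Nonempty X] [Nonempty Y]
    (c : X → Y → ℝ) (hc : ∀ x y, 0 ≤ c x y)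
    (a b : ℝ) (ha : 0 < a) (hb : 0 < b)
    (hrow : ∀ x : X, a ≤ ∑ y, c x y)
    (hcol : ∀ y : Y, b ≤ ∑ x, c x y)
    (F : ℝ) (hF : F = min (a * (Fintype.card X : ℝ)) (b * (Fintype.card Y : ℝ)))
    (hmarriage : ∀ (S : Finset X) (T : Finset Y),
      a * (S.card : ℝ) + b * (T.card : ℝ) ≤ (∑ x ∈ S, ∑ y ∈ T, c x y) + F) :
    (∃ f : X → Y → ℝ, IsUniformFlowB c f ∧ (∑ x, ∑ y, f x y) = F) ∧
      F ≤ maxUFlowB c := by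
  have hnX : (0 : ℝ) < Fintype.card X := by exact_mod_cast Fintype.card_pos
  have hnY : (0 : ℝ) < Fintype.card Y := by exact_mod_cast Fintype.card_pos
  have hFX : F / Fintype.card X ≤ a := by
    rw [div_le_iff₀ hnX, hF]; exact min_le_left _ _
  have hFY : F / Fintype.card Y ≤ b := by
    rw [div_le_iff₀ hnY, hF]; exact min_le_right _ _
  obtain ⟨f, h0, h1, hr, hl⟩ := flow_feas c hc (F / Fintype.card X) (F / Fintype.card Y) F
    (div_mul_cancel₀ _ hnX.ne') (div_mul_cancel₀ _ hnY.ne') (fun S T => by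
      have := hmarriage S T
      have := mul_le_mul_of_nonneg_right hFX (Nat.cast_nonneg (α := ℝ) S.card)
      have := mul_le_mul_of_nonneg_right hFY (Nat.cast_nonneg (α := ℝ) T.card)
      linarith)
  have hex : ∃ f : X → Y → ℝ, IsUniformFlowB c f ∧ (∑ x, ∑ y, f x y) = F := by
    refine ⟨f, ⟨h0, h1, fun x₁ x₂ => by rw [hr, hr], fun y₁ y₂ => by rw [hl, hl]⟩, ?_⟩
    simp only [hr]
    simp only [Finset.sum_const, Finset.card_univ, nsmul_eq_mul]
    exact mul_div_cancel₀ _ hnX.ne'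
  refine ⟨hex, le_csSup ⟨∑ x, ∑ y, c x y, ?_⟩ hex⟩
  rintro w ⟨g, hg, rfl⟩
  exact Finset.sum_le_sum fun x _ => Finset.sum_le_sum fun y _ => hg.2.1 x y
end

section
/- Let G = (X, c, {s}, {t}) be a network with single source s and single target t, s ≠ t, and let P = {P_0, P_1, …, P_k} be a stable coloring of the weighted graph (X, c) (i.e., a 0-stable coloring with respect to the weight function c) with P_0 = {s} and P_k = {t}. Define ĉ₁(i,j) := maxUFlow(P_i, P_j, c) and ĉ₂(i,j) := c(P_i, P_j) on node set {0,…,k}. Then ĉ₁ = ĉ₂, and consequently, letting Ĝ₁, Ĝ₂ be the networks on {0,…,k} with source {0}, target {k} and capacities ĉ₁, ĉ₂, we have maxFlow(Ĝ₁) = maxFlow(G) = maxFlow(Ĝ₂). -/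
open BigOperators

/-- If `P_0 = {s}, P_1, …, P_k = {t}` is a stable (0-stable) coloring of the
weighted graph `(X, c)`, then `ĉ₁(i,j) = maxUFlow(P_i,P_j,c)` coincides with
`ĉ₂(i,j) = c(P_i,P_j)`, and consequently
`maxFlow(Ĝ₁) = maxFlow(G) = maxFlow(Ĝ₂)`. -/
theorem stable_coloring_maxflow_exact {X : Type*} [Fintype X] [DecidableEq X]
    (c : X → X → ℝ) (hc : ∀ x y, 0 ≤ c x y)
    (s t : X) (hst : s ≠ t) (k : ℕ)
    (P : Fin (k + 1) → Finset X)
    (hpart : ∀ x : X, ∃! i, x ∈ P i)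
    (hP0 : P 0 = {s}) (hPk : P (Fin.last k) = {t})
    (hstable : ∀ i j : Fin (k + 1),
      (∀ x₁ ∈ P i, ∀ x₂ ∈ P i, (∑ y ∈ P j, c x₁ y) = (∑ y ∈ P j, c x₂ y)) ∧
      (∀ y₁ ∈ P j, ∀ y₂ ∈ P j, (∑ x ∈ P i, c x y₁) = (∑ x ∈ P i, c x y₂))) :
    (∀ i j : Fin (k + 1),
        maxUFlow c (P i) (P j) = ∑ x ∈ P i, ∑ y ∈ P j, c x y) ∧
    maxFlow (fun i j : Fin (k + 1) => maxUFlow c (P i) (P j))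
        {(0 : Fin (k + 1))} {Fin.last k} = maxFlow c {s} {t} ∧
    maxFlow c {s} {t}
      = maxFlow (fun i j : Fin (k + 1) => ∑ x ∈ P i, ∑ y ∈ P j, c x y)
          {(0 : Fin (k + 1))} {Fin.last k} := by
  have hU : ∀ i j : Fin (k + 1),
      maxUFlow c (P i) (P j) = ∑ x ∈ P i, ∑ y ∈ P j, c x y := by
    intro i j
    apply IsGreatest.csSup_eq
    refine ⟨⟨c, ⟨hc, fun _ _ _ _ => le_rfl, (hstable i j).1, (hstable i j).2⟩, rfl⟩, ?_⟩
    rintro v ⟨f, hf, rfl⟩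
    exact Finset.sum_le_sum fun x hx => Finset.sum_le_sum fun y hy => hf.2.1 x hx y hy
  choose col hcol hcolu using hpart
  have hmem : ∀ x i, x ∈ P i ↔ col x = i :=
    fun x i => ⟨fun h => (hcolu x i h).symm, fun h => h ▸ hcol x⟩
  have hPf : ∀ i, P i = Finset.univ.filter (fun x => col x = i) := by
    intro i; ext x; simp [hmem]
  have hsum : ∀ g : X → ℝ, ∑ y, g y = ∑ j, ∑ y ∈ P j, g y := by
    intro g
    simp only [hPf]
    exact (Finset.sum_fiberwise Finset.univ col g).symm
  have hmain : maxFlow c {s} {t}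
      = maxFlow (fun i j : Fin (k + 1) => ∑ x ∈ P i, ∑ y ∈ P j, c x y)
          {(0 : Fin (k + 1))} {Fin.last k} := by
    unfold maxFlow
    congr 1
    ext v
    constructor
    · rintro ⟨f, ⟨h0, h1, h2⟩, rfl⟩
      refine ⟨fun i j => ∑ x ∈ P i, ∑ y ∈ P j, f x y, ⟨?_, ?_, ?_⟩, ?_⟩
      · intro i j
        exact Finset.sum_nonneg fun x _ => Finset.sum_nonneg fun y _ => h0 x y
      · intro i j
        exact Finset.sum_le_sum fun x _ => Finset.sum_le_sum fun y _ => h1 x y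
      · intro i hi0 hik
        simp only [Finset.mem_singleton] at hi0 hik
        have e1 : ∑ j, ∑ x ∈ P j, ∑ y ∈ P i, f x y = ∑ z ∈ P i, ∑ x, f x z := by
          rw [← hsum (fun x => ∑ y ∈ P i, f x y), Finset.sum_comm]
        have e2 : ∑ j, ∑ x ∈ P i, ∑ y ∈ P j, f x y = ∑ z ∈ P i, ∑ x, f z x := by
          rw [Finset.sum_comm]
          exact Finset.sum_congr rfl fun x _ => (hsum (f x)).symm
        rw [e1, e2]
        refine Finset.sum_congr rfl fun z hz => h2 z ?_ ?_
        · rw [← hP0, hmem]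
          rw [hmem] at hz
          exact fun h => hi0 (hz.symm.trans h)
        · rw [← hPk, hmem]
          rw [hmem] at hz
          exact fun h => hik (hz.symm.trans h)
      · simp [flowValue, hP0, hsum (f s)]
    · rintro ⟨F, ⟨h0, h1, h2⟩, rfl⟩
      set C : Fin (k + 1) → Fin (k + 1) → ℝ := fun i j => ∑ x ∈ P i, ∑ y ∈ P j, c x y with hC
      have hC0 : ∀ i j, 0 ≤ C i j := fun i j =>
        Finset.sum_nonneg fun x _ => Finset.sum_nonneg fun y _ => hc x y
      have hrow : ∀ i j, ∀ x ∈ P i, C i j = (P i).card * ∑ y ∈ P j, c x y := by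
        intro i j x hx
        rw [← nsmul_eq_mul]
        exact Finset.sum_eq_card_nsmul fun x' hx' => (hstable i j).1 x' hx' x hx
      have hcl : ∀ i j, ∀ y ∈ P j, C i j = (P j).card * ∑ x ∈ P i, c x y := by
        intro i j y hy
        rw [← nsmul_eq_mul, hC]
        simp only
        rw [Finset.sum_comm]
        exact Finset.sum_eq_card_nsmul fun y' hy' => (hstable i j).2 y' hy' y hy
      have harith : ∀ (i j : Fin (k + 1)) (n a : ℝ), n ≠ 0 → C i j = n * a →
          a * (F i j / C i j) = F i j / n := by
        intro i j n a hn h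
        by_cases hz : C i j = 0
        · have : F i j = 0 := le_antisymm (hz ▸ h1 i j) (h0 i j)
          simp [this]
        · have ha : a ≠ 0 := by rintro rfl; exact hz (by simpa using h)
          rw [h]
          field_simp
      have hcard : ∀ i, ∀ x ∈ P i, ((P i).card : ℝ) ≠ 0 := by
        intro i x hx
        exact_mod_cast Finset.card_ne_zero_of_mem hx
      let f : X → X → ℝ := fun x y => c x y * (F (col x) (col y) / C (col x) (col y))
      have hout : ∀ x, ∑ y, f x y = (∑ j, F (col x) j) / (P (col x)).card := by
        intro x
        rw [hsum, Finset.sum_div]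
        refine Finset.sum_congr rfl fun j _ => ?_
        rw [← harith _ j _ _ (hcard _ x (hcol x)) (hrow _ j x (hcol x)), Finset.sum_mul]
        refine Finset.sum_congr rfl fun y hy => ?_
        simp only [f, (hmem y j).1 hy]
      have hin : ∀ y, ∑ x, f x y = (∑ i, F i (col y)) / (P (col y)).card := by
        intro y
        rw [hsum, Finset.sum_div]
        refine Finset.sum_congr rfl fun i _ => ?_
        rw [← harith i _ _ _ (hcard _ y (hcol y)) (hcl i _ y (hcol y)), Finset.sum_mul]
        refine Finset.sum_congr rfl fun x hx => ?_
        simp only [f, (hmem x i).1 hx]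
      refine ⟨f, ⟨?_, ?_, ?_⟩, ?_⟩
      · intro x y
        exact mul_nonneg (hc x y) (div_nonneg (h0 _ _) (hC0 _ _))
      · intro x y
        exact mul_le_of_le_one_right (hc x y) (div_le_one_of_le₀ (h1 _ _) (hC0 _ _))
      · intro z hzs hzt
        rw [hin, hout, h2 (col z)]
        · rw [Finset.mem_singleton, ← hmem, hP0]; exact hzs
        · rw [Finset.mem_singleton, ← hmem, hPk]; exact hzt
      · have hs : col s = 0 := by rw [← hmem, hP0]; simp
        simp [flowValue, hout, hs, hP0]
  refine ⟨hU, ?_, hmain⟩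
  simp only [hU]
  exact hmain.symm
end

section
/- Let ∼ be an equivalence relation on ℝ that is a congruence with respect to addition, i.e., x ∼ y implies (x + z) ∼ (y + z) for all z ∈ ℝ. Let (X, w) be a finite weighted directed graph. If partitions P and Q of X are both ∼-quasi-stable colorings of (X, w), then their join P ∨ Q (the finest partition that coarsens both P and Q) is also a ∼-quasi-stable coloring of (X, w). -/
open BigOperators

open Classical in
/-- `w(x, P_y)`: total weight from the node `x` to the block of `y`
in the partition given by the setoid `s`. -/
noncomputable def blockOut {X : Type*} [Fintype X] (s : Setoid X)
    (w : X → X → ℝ) (x y : X) : ℝ :=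
  ∑ z ∈ Finset.univ.filter (fun z => s.r y z), w x z

open Classical in
/-- `w(P_y, x)`: total weight from the block of `y` into the node `x`
in the partition given by the setoid `s`. -/
noncomputable def blockIn {X : Type*} [Fintype X] (s : Setoid X)
    (w : X → X → ℝ) (x y : X) : ℝ :=
  ∑ z ∈ Finset.univ.filter (fun z => s.r y z), w z x

/-- The partition given by the setoid `s` is a `∼`-quasi-stable coloring of the
weighted directed graph `(X, w)`: any two nodes of the same color have similar
total outgoing weight to every color, and similar total incoming weight from
every color. -/
def QuasiStable {X : Type*} [Fintype X] (sim : ℝ → ℝ → Prop)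
    (s : Setoid X) (w : X → X → ℝ) : Prop :=
  (∀ x₁ x₂ : X, s.r x₁ x₂ → ∀ y : X,
     sim (blockOut s w x₁ y) (blockOut s w x₂ y)) ∧
  (∀ x₁ x₂ : X, s.r x₁ x₂ → ∀ y : X,
     sim (blockIn s w x₁ y) (blockIn s w x₂ y))

theorem sim_sum_aux {ι : Type*} (sim : ℝ → ℝ → Prop) (hsim : Equivalence sim)
    (hcong : ∀ x y z : ℝ, sim x y → sim (x + z) (y + z))
    (S : Finset ι) (f g : ι → ℝ) (h : ∀ i ∈ S, sim (f i) (g i)) :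
    sim (∑ i ∈ S, f i) (∑ i ∈ S, g i) := by
  classical
  induction S using Finset.induction_on with
  | empty => simpa using hsim.refl 0
  | insert a S ha ih =>
    rw [Finset.sum_insert ha, Finset.sum_insert ha]
    have h1 := hcong _ _ (∑ i ∈ S, f i) (h a (Finset.mem_insert_self a S))
    have h2 := hcong _ _ (g a) (ih fun i hi => h i (Finset.mem_insert_of_mem hi))
    rw [add_comm _ (g a), add_comm _ (g a)] at h2
    exact hsim.trans h1 h2

theorem blockOut_aux {X : Type*} [Fintype X] (sim : ℝ → ℝ → Prop) (hsim : Equivalence sim)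
    (hcong : ∀ x y z : ℝ, sim x y → sim (x + z) (y + z))
    (w : X → X → ℝ) (s t : Setoid X) (hst : s ≤ t) (x₁ x₂ : X)
    (h : ∀ y, sim (blockOut s w x₁ y) (blockOut s w x₂ y)) (y : X) :
    sim (blockOut t w x₁ y) (blockOut t w x₂ y) := by
  classical
  unfold blockOut at *
  rw [← Finset.sum_fiberwise _ (fun z => Quotient.mk s z) (w x₁),
    ← Finset.sum_fiberwise _ (fun z => Quotient.mk s z) (w x₂)]
  apply sim_sum_aux sim hsim hcong
  intro q _
  induction q using Quotient.inductionOn with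
  | h a =>
    by_cases hya : t.r y a
    · have e : (Finset.univ.filter (fun z => t.r y z)).filter
          (fun z => Quotient.mk s z = Quotient.mk s a)
          = Finset.univ.filter (fun z => s.r a z) := by
        ext z
        simp only [Finset.mem_filter, Finset.mem_univ, true_and]
        constructor
        · rintro ⟨_, h2⟩
          exact s.symm' (Quotient.exact h2)
        · intro h2
          exact ⟨t.trans' hya (hst h2), Quotient.sound (s.symm' h2)⟩
      convert h a using 2
    · have e : (Finset.univ.filter (fun z => t.r y z)).filter
          (fun z => Quotient.mk s z = Quotient.mk s a) = ∅ := by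
        ext z
        simp only [Finset.mem_filter, Finset.mem_univ, true_and, Finset.notMem_empty, iff_false]
        rintro ⟨h1, h2⟩
        exact hya (t.trans' h1 (hst (Quotient.exact h2)))
      rw [e]
      simpa using hsim.refl 0

theorem sup_aux {X : Type*} [Fintype X] (sim : ℝ → ℝ → Prop) (hsim : Equivalence sim)
    (hcong : ∀ x y z : ℝ, sim x y → sim (x + z) (y + z))
    (w : X → X → ℝ) (P Q : Setoid X)
    (hP : ∀ x₁ x₂ : X, P.r x₁ x₂ → ∀ y : X, sim (blockOut P w x₁ y) (blockOut P w x₂ y))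
    (hQ : ∀ x₁ x₂ : X, Q.r x₁ x₂ → ∀ y : X, sim (blockOut Q w x₁ y) (blockOut Q w x₂ y)) :
    ∀ x₁ x₂ : X, (P ⊔ Q).r x₁ x₂ → ∀ y : X,
      sim (blockOut (P ⊔ Q) w x₁ y) (blockOut (P ⊔ Q) w x₂ y) := by
  let R : Setoid X :=
    { r := fun x₁ x₂ => ∀ y, sim (blockOut (P ⊔ Q) w x₁ y) (blockOut (P ⊔ Q) w x₂ y)
      iseqv := ⟨fun _ _ => hsim.refl _, fun h y => hsim.symm (h y),
        fun h k y => hsim.trans (h y) (k y)⟩ }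
  have hR : P ⊔ Q ≤ R := sup_le
    (fun {a b} hab => blockOut_aux sim hsim hcong w P (P ⊔ Q) le_sup_left a b (hP a b hab))
    (fun {a b} hab => blockOut_aux sim hsim hcong w Q (P ⊔ Q) le_sup_right a b (hQ a b hab))
  exact fun a b hab => hR hab

/-- If `∼` is an equivalence relation on `ℝ` that is a congruence for addition,
and the partitions `P`, `Q` (as setoids, ordered so that `≤` is refinement) are
both `∼`-quasi-stable colorings of `(X, w)`, then so is their join `P ⊔ Q`. -/
theorem quasiStable_sup {X : Type*} [Fintype X]
    (sim : ℝ → ℝ → Prop) (hsim : Equivalence sim)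
    (hcong : ∀ x y z : ℝ, sim x y → sim (x + z) (y + z))
    (w : X → X → ℝ) (P Q : Setoid X)
    (hP : QuasiStable sim P w) (hQ : QuasiStable sim Q w) :
    QuasiStable sim (P ⊔ Q) w := by
  exact ⟨sup_aux sim hsim hcong w P Q hP.1 hQ.1,
    sup_aux sim hsim hcong (fun a b => w b a) P Q hP.2 hQ.2⟩
end

section
/- Let ∼ be an equivalence relation on ℝ that is a congruence with respect to addition, i.e., x ∼ y implies (x + z) ∼ (y + z) for all z ∈ ℝ. Then every finite weighted directed graph (X, w) admits a unique maximum ∼-quasi-stable coloring: there exists a ∼-quasi-stable partition P* of X such that every ∼-quasi-stable partition of X refines P*. -/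
open BigOperators

theorem qs_aux {X : Type*} [Fintype X] [DecidableEq X]
    (sim : ℝ → ℝ → Prop) (hsim : Equivalence sim)
    (hcong : ∀ x y z : ℝ, sim x y → sim (x + z) (y + z))
    (P : Setoid X) (f g : X → ℝ) (A : Finset X)
    (hA : ∀ a ∈ A, ∀ b, P.r a b → b ∈ A)
    (h : ∀ (y : X) (B : Finset X), (∀ z, z ∈ B ↔ P.r y z) → sim (∑ z ∈ B, f z) (∑ z ∈ B, g z)) :
    sim (∑ z ∈ A, f z) (∑ z ∈ A, g z) := by
  classical
  have hadd : ∀ a b c d, sim a b → sim c d → sim (a + c) (b + d) := by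
    intro a b c d h1 h2
    have h3 := hcong _ _ b h2
    rw [add_comm c, add_comm d] at h3
    exact hsim.trans (hcong _ _ c h1) h3
  have hm : ∀ i ∈ A, (Quotient.mk P i) ∈ A.image (Quotient.mk P) :=
    fun i hi => Finset.mem_image_of_mem _ hi
  rw [← Finset.sum_fiberwise_of_maps_to hm f, ← Finset.sum_fiberwise_of_maps_to hm g]
  have key : ∀ T : Finset (Quotient P), T ⊆ A.image (Quotient.mk P) →
      sim (∑ q ∈ T, ∑ z ∈ A with Quotient.mk P z = q, f z)
        (∑ q ∈ T, ∑ z ∈ A with Quotient.mk P z = q, g z) := by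
    intro T
    induction T using Finset.induction_on with
    | empty => intro _; simpa using hsim.refl 0
    | insert q T hq ih =>
      intro hT
      rw [Finset.sum_insert hq, Finset.sum_insert hq]
      refine hadd _ _ _ _ ?_ (ih fun x hx => hT (Finset.mem_insert_of_mem hx))
      obtain ⟨y, hy, rfl⟩ := Finset.mem_image.1 (hT (Finset.mem_insert_self q T))
      refine h y _ fun z => ?_
      rw [Finset.mem_filter]
      constructor
      · rintro ⟨_, h2⟩
        exact P.symm (Quotient.exact h2)
      · intro h2
        exact ⟨hA y hy z h2, Quotient.sound (P.symm h2)⟩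
  exact key _ (Finset.Subset.refl _)

/-- If `∼` is an equivalence relation on `ℝ` that is a congruence for addition,
then every finite weighted directed graph `(X, w)` admits a unique maximum
`∼`-quasi-stable coloring: a `∼`-quasi-stable partition `P*` (as a setoid,
ordered so that `≤` is refinement) that is refined by every `∼`-quasi-stable
partition. -/
theorem exists_maximum_quasiStable {X : Type*} [Fintype X]
    (sim : ℝ → ℝ → Prop) (hsim : Equivalence sim)
    (hcong : ∀ x y z : ℝ, sim x y → sim (x + z) (y + z))
    (w : X → X → ℝ) :
    ∃ Pstar : Setoid X, QuasiStable sim Pstar w ∧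
      ∀ P : Setoid X, QuasiStable sim P w → P ≤ Pstar := by
  classical
  refine ⟨sSup {P | QuasiStable sim P w}, ?_, fun P hP => le_sSup hP⟩
  set S := sSup {P : Setoid X | QuasiStable sim P w} with hS
  have main : ∀ F : X → X → ℝ,
      (∀ P : Setoid X, QuasiStable sim P w → ∀ x₁ x₂, P.r x₁ x₂ → ∀ (y : X) (B : Finset X),
        (∀ z, z ∈ B ↔ P.r y z) → sim (∑ z ∈ B, F x₁ z) (∑ z ∈ B, F x₂ z)) →
      ∀ x₁ x₂, S.r x₁ x₂ → ∀ A : Finset X, (∀ a ∈ A, ∀ b, S.r a b → b ∈ A) →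
        sim (∑ z ∈ A, F x₁ z) (∑ z ∈ A, F x₂ z) := by
    intro F hF x₁ x₂ hx A hA
    let T : Setoid X := ⟨fun a b => sim (∑ z ∈ A, F a z) (∑ z ∈ A, F b z),
      ⟨fun _ => hsim.refl _, fun h => hsim.symm h, fun h h' => hsim.trans h h'⟩⟩
    have hle : S ≤ T := by
      refine sSup_le fun P hP a b hab => ?_
      have hPS : P ≤ S := le_sSup hP
      exact qs_aux sim hsim hcong P _ _ A (fun c hc d hcd => hA c hc d (hPS hcd))
        (fun y B hB => hF P hP a b hab y B hB)
    exact hle hx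
  constructor
  · intro x₁ x₂ hx y
    refine main w ?_ x₁ x₂ hx _ ?_
    · intro P hP a b hab y B hB
      have := hP.1 a b hab y
      have e : B = Finset.univ.filter (fun z => P.r y z) := by ext z; simp [hB]
      rw [e]
      exact this
    · intro a ha b hab
      simp only [Finset.mem_filter, Finset.mem_univ, true_and] at ha ⊢
      exact S.trans ha hab
  · intro x₁ x₂ hx y
    refine main (fun x z => w z x) ?_ x₁ x₂ hx _ ?_
    · intro P hP a b hab y B hB
      have := hP.2 a b hab y
      have e : B = Finset.univ.filter (fun z => P.r y z) := by ext z; simp [hB]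
      rw [e]
      exact this
    · intro a ha b hab
      simp only [Finset.mem_filter, Finset.mem_univ, true_and] at ha ⊢
      exact S.trans ha hab
end
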